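/- arXiv:1809.00779 — 3 statements merged into one kernel-verified Lean document; each statement's English description precedes it below -/
import Mathlib

section
/- For all integers n₁ ≥ n₂ ≥ n₃ ≥ 2, there exists a function c from the edge set of the complete graph K_{2n₁+n₂+n₃−3} to {1,2,3} such that for each i ∈ {1,2,3} there is no cycle of length 2nᵢ in K_{2n₁+n₂+n₃−3} all of whose edges receive color i under c. Consequently R(C_{2n₁}, C_{2n₂}, C_{2n₃}) ≥ 2n₁+n₂+n₃−2. -/
/-- `F` has a cycle of length `m`, all of whose edges get color `i` under `c`. -/
def HasMonoCycle {V : Type*} (F : SimpleGraph V) {k : ℕ} (c : F.edgeSet → Fin k)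
    (i : Fin k) (m : ℕ) : Prop :=
  ∃ (v : V) (w : F.Walk v v), w.IsCycle ∧ w.length = m ∧
    ∀ e (h : e ∈ w.edges), c ⟨e, w.edges_subset_edgeSet h⟩ = i

/-- `F → (C_{n 0}, …, C_{n (k-1)})`: every `k`-coloring of the edges of `F` yields,
for some color `i`, a cycle on `n i` vertices all of whose edges have color `i`. -/
def ArrowsCycles {V : Type*} (F : SimpleGraph V) {k : ℕ} (n : Fin k → ℕ) : Prop :=
  ∀ c : F.edgeSet → Fin k, ∃ i : Fin k, HasMonoCycle F c i (n i)

/-- The Ramsey number `R(C_{n 0}, …, C_{n (k-1)})`, the least `N` such that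
`K_N → (C_{n 0}, …, C_{n (k-1)})`. -/
noncomputable def ramseyCycles {k : ℕ} (n : Fin k → ℕ) : ℕ :=
  sInf {N : ℕ | ArrowsCycles (⊤ : SimpleGraph (Fin N)) n}

open SimpleGraph Finset

/-- A graph containing `K_{n,n}` contains a cycle of length `2 * n`. -/
lemma cycleGraph_isContained_of_bipartite {V : Type*} {G : SimpleGraph V} {n : ℕ}
    {a b : Fin n → V} (ha : a.Injective) (hb : b.Injective) (hab : ∀ i j, G.Adj (a i) (b j)) :
    cycleGraph (2 * n) ⊑ G := by
  let half (x : Fin (2 * n)) : Fin n := ⟨x.val / 2, by omega⟩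
  refine ⟨⟨⟨fun x ↦ if x.val % 2 = 0 then a (half x) else b (half x), ?_⟩, ?_⟩⟩
  · intro x y hxy
    have hne := (cycleGraph.bicoloring_of_even (2 * n) (even_two_mul n)).valid hxy
    change decide (x.val % 2 = 0) ≠ decide (y.val % 2 = 0) at hne
    by_cases hx : x.val % 2 = 0 <;> by_cases hy : y.val % 2 = 0 <;> simp only [hx, hy] at hne ⊢
    · exact absurd rfl hne
    · exact hab _ _
    · exact (hab _ _).symm
    · exact absurd rfl hne
  · intro x y hxy
    change (if x.val % 2 = 0 then a (half x) else b (half x)) =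
      if y.val % 2 = 0 then a (half y) else b (half y) at hxy
    split_ifs at hxy with hx hy hy
    · have := congrArg Fin.val (ha hxy)
      simp only [half] at this
      omega
    · exact absurd hxy (hab _ _).ne
    · exact absurd hxy (hab _ _).ne'
    · have := congrArg Fin.val (hb hxy)
      simp only [half] at this
      omega

/-- The bipartite pigeonhole principle: a `k`-colored complete bipartite graph with large enough
parts contains a monochromatic complete bipartite graph with both parts of size `s`. -/
lemma exists_monochromatic_rectangle {k s M L : ℕ} [NeZero k] (f : Fin L → Fin M → Fin k)
    (hM : k * s ≤ M) (hL : k ^ M * s ≤ L) :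
    ∃ (i : Fin k) (S : Finset (Fin L)) (T : Finset (Fin M)),
      s ≤ #S ∧ s ≤ #T ∧ ∀ x ∈ S, ∀ y ∈ T, f x y = i := by
  classical
  obtain ⟨g, hg⟩ := Fintype.exists_le_card_fiber_of_mul_le_card (f := f) (n := s) (by simpa)
  obtain ⟨i, hi⟩ := Fintype.exists_le_card_fiber_of_mul_le_card (f := g) (n := s) (by simpa)
  refine ⟨i, _, _, hg, hi, fun x hx y hy ↦ ?_⟩
  simp only [mem_filter, mem_univ, true_and] at hx hy
  rw [hx, hy]

/-- The spanning subgraph of the edges of color `i`. -/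
def colorGraph {V : Type*} {F : SimpleGraph V} {k : ℕ} (c : F.edgeSet → Fin k) (i : Fin k) :
    SimpleGraph V :=
  SimpleGraph.fromEdgeSet {e | ∃ h : e ∈ F.edgeSet, c ⟨e, h⟩ = i}

lemma hasMonoCycle_of_isContained {V : Type*} {F : SimpleGraph V} {k : ℕ} {c : F.edgeSet → Fin k}
    {i : Fin k} {m : ℕ} (hm : 2 < m) (h : cycleGraph m ⊑ colorGraph c i) :
    HasMonoCycle F c i m := by
  obtain ⟨v, p, hp, hlen⟩ := (cycleGraph_isContained_iff hm).mp h
  have hcol {e : Sym2 V} (he : e ∈ (colorGraph c i).edgeSet) :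
      ∃ h : e ∈ F.edgeSet, c ⟨e, h⟩ = i := by
    rw [colorGraph, edgeSet_fromEdgeSet] at he
    exact he.1
  have hle : colorGraph c i ≤ F := edgeSet_subset_edgeSet.mp fun e he ↦ (hcol he).1
  refine ⟨v, p.mapLe hle, hp.mapLe hle, by simpa using hlen, fun e he ↦ ?_⟩
  have he' : e ∈ p.edges := by simpa using he
  exact (hcol (p.edges_subset_edgeSet he')).2

/-- Ramsey numbers of even cycles are finite. -/
lemma exists_arrowsCycles_two_mul {k : ℕ} [NeZero k] (n : Fin k → ℕ) (hn : ∀ i, 2 ≤ n i) :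
    ∃ N : ℕ, ArrowsCycles (⊤ : SimpleGraph (Fin N)) fun i ↦ 2 * n i := by
  let s := univ.sup n
  let M := k * s
  let L := k ^ M * s
  refine ⟨L + M, fun c ↦ ?_⟩
  have hne (x : Fin L) (y : Fin M) : Fin.castAdd M x ≠ Fin.natAdd L y := by
    intro h
    have := congrArg Fin.val h
    simp only [Fin.val_castAdd, Fin.val_natAdd] at this
    omega
  obtain ⟨i, S, T, hS, hT, h⟩ := exists_monochromatic_rectangle (s := s)
    (fun (x : Fin L) (y : Fin M) ↦
      c ⟨s(Fin.castAdd M x, Fin.natAdd L y), (hne x y : _)⟩) le_rfl le_rfl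
  have his : n i ≤ s := le_sup (mem_univ i)
  refine ⟨i, hasMonoCycle_of_isContained (by have := hn i; dsimp only; omega)
    (cycleGraph_isContained_of_bipartite
      (a := Fin.castAdd M ∘ S.orderEmbOfCardLe (his.trans hS))
      (b := Fin.natAdd L ∘ T.orderEmbOfCardLe (his.trans hT))
      ((Fin.castAdd_injective _ _).comp (RelEmbedding.injective _))
      ((Fin.natAdd_injective _ _).comp (RelEmbedding.injective _)) fun x y ↦ ?_)⟩
  rw [colorGraph, fromEdgeSet_adj]
  exact ⟨⟨_, h _ (S.orderEmbOfCardLe_mem _ x) _ (T.orderEmbOfCardLe_mem _ y)⟩, hne _ _⟩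

lemma SimpleGraph.Walk.mk_getVert_mem_edges {V : Type*} {G : SimpleGraph V} {u v : V}
    (w : G.Walk u v) {i : ℕ} (hi : i < w.length) : s(w.getVert i, w.getVert (i + 1)) ∈ w.edges :=
  w.mem_edges_toSubgraph.mp (w.toSubgraph_adj_getVert hi)

/-- A cycle has at most as many edges as any set containing its vertices has elements. -/
lemma SimpleGraph.Walk.IsCycle.length_le_card {V : Type*} {G : SimpleGraph V} {v : V}
    {w : G.Walk v v} (hw : w.IsCycle) {S : Finset V}
    (hS : ∀ e ∈ w.edges, ∀ x ∈ e, x ∈ S) : w.length ≤ #S := by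
  rw [← card_range w.length]
  refine card_le_card_of_injOn w.getVert (fun i hi ↦ ?_) fun i hi j hj hij ↦ ?_
  · have hi : i < w.length := by simpa using hi
    exact hS _ (w.mk_getVert_mem_edges hi) _ (Sym2.mem_mk_left _ _)
  · simp only [coe_range, Set.mem_Iio] at hi hj
    exact hw.getVert_injOn' (by rw [Set.mem_ofPred_eq]; omega)
      (by rw [Set.mem_ofPred_eq]; omega) hij

/-- A vertex cover of a cycle of length `2 * m` has at least `m` elements. -/
lemma SimpleGraph.Walk.IsCycle.le_card_of_cover {V : Type*} {G : SimpleGraph V} {v : V}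
    {w : G.Walk v v} (hw : w.IsCycle) {m : ℕ} (hm : w.length = 2 * m) {S : Finset V}
    (hS : ∀ e ∈ w.edges, ∃ x ∈ e, x ∈ S) : m ≤ #S := by
  have key (j : ℕ) (hj : j < m) : ∃ t, t / 2 = j ∧ w.getVert t ∈ S := by
    obtain ⟨x, hx, hxS⟩ := hS _ (w.mk_getVert_mem_edges (i := 2 * j) (by omega))
    rcases Sym2.mem_iff.mp hx with rfl | rfl
    · exact ⟨2 * j, by omega, hxS⟩
    · exact ⟨2 * j + 1, by omega, hxS⟩
  choose! t ht htS using key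
  rw [← card_range m]
  refine card_le_card_of_injOn (w.getVert ∘ t) (fun j hj ↦ htS j (by simpa using hj))
    fun i hi j hj hij ↦ ?_
  simp only [coe_range, Set.mem_Iio] at hi hj
  have hti := ht i hi
  have htj := ht j hj
  have := hw.getVert_injOn' (by rw [Set.mem_ofPred_eq]; omega)
    (by rw [Set.mem_ofPred_eq]; omega) hij
  omega

/-- If `V` is covered by sets `A`, `B`, `C` with `#A < 2 * n₁`, `#B < n₂` and `#C < n₃`, then the
complete graph on `V` has a `3`-coloring without monochromatic cycles of lengths
`2 * n₁`, `2 * n₂`, `2 * n₃` in the respective colors. -/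
lemma exists_coloring_of_cover {V : Type*} {n₁ n₂ n₃ : ℕ} {A B C : Finset V}
    (hcover : ∀ x, x ∈ A ∨ x ∈ B ∨ x ∈ C) (hA : #A < 2 * n₁) (hB : #B < n₂) (hC : #C < n₃) :
    ∃ c : (⊤ : SimpleGraph V).edgeSet → Fin 3,
      ∀ i : Fin 3, ¬ HasMonoCycle ⊤ c i (2 * ![n₁, n₂, n₃] i) := by
  classical
  refine ⟨fun e ↦ if ∃ x ∈ e.1, x ∈ C then 2 else if ∃ x ∈ e.1, x ∈ B then 1 else 0, ?_⟩
  rintro i ⟨v, w, hw, hlen, hcol⟩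
  dsimp only at hcol
  fin_cases i
  · refine absurd (hw.length_le_card (S := A) fun e he x hx ↦ ?_) ?_
    · have := hcol e he
      split_ifs at this with h₂ h₁
      · exact absurd this (by decide)
      · exact absurd this (by decide)
      · exact (hcover x).resolve_right fun h ↦
          h.elim (fun h ↦ h₁ ⟨x, hx, h⟩) fun h ↦ h₂ ⟨x, hx, h⟩
    · rw [hlen]
      exact hA.not_ge
  · refine absurd (hw.le_card_of_cover (m := n₂) hlen (S := B) fun e he ↦ ?_) hB.not_ge
    have := hcol e he
    split_ifs at this with h₂ h₁
    · exact absurd this (by decide)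
    · exact h₁
    · exact absurd this (by decide)
  · refine absurd (hw.le_card_of_cover (m := n₃) hlen (S := C) fun e he ↦ ?_) hC.not_ge
    have := hcol e he
    split_ifs at this with h₂ h₁
    · exact h₂
    · exact absurd this (by decide)
    · exact absurd this (by decide)

lemma card_filter_val_mem_Ico_le {N a b : ℕ} :
    #{x : Fin N | a ≤ x.val ∧ x.val < b} ≤ b - a := by
  rw [← Nat.card_Ico]
  exact card_le_card_of_injOn Fin.val (fun x hx ↦ by simpa using hx) Fin.val_injective.injOn

lemma exists_coloring_of_le {n₁ n₂ n₃ N : ℕ} (h₁ : 1 ≤ n₁) (h₂ : 1 ≤ n₂) (h₃ : 1 ≤ n₃)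
    (hN : N ≤ 2 * n₁ + n₂ + n₃ - 3) :
    ∃ c : (⊤ : SimpleGraph (Fin N)).edgeSet → Fin 3,
      ∀ i : Fin 3, ¬ HasMonoCycle ⊤ c i (2 * ![n₁, n₂, n₃] i) := by
  refine exists_coloring_of_cover
    (A := {x | 0 ≤ x.val ∧ x.val < 2 * n₁ - 1})
    (B := {x | 2 * n₁ - 1 ≤ x.val ∧ x.val < 2 * n₁ + n₂ - 2})
    (C := {x | 2 * n₁ + n₂ - 2 ≤ x.val ∧ x.val < 2 * n₁ + n₂ + n₃ - 3}) (fun x ↦ ?_)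
    ?_ ?_ ?_
  · simp only [mem_filter, mem_univ, true_and]
    omega
  all_goals
    refine card_filter_val_mem_Ico_le.trans_lt ?_
    omega

theorem stmt6 (n₁ n₂ n₃ : ℕ) (h21 : n₂ ≤ n₁) (h32 : n₃ ≤ n₂) (h2 : 2 ≤ n₃) :
    (∃ c : (⊤ : SimpleGraph (Fin (2 * n₁ + n₂ + n₃ - 3))).edgeSet → Fin 3,
      ∀ i : Fin 3, ¬ HasMonoCycle ⊤ c i (2 * ![n₁, n₂, n₃] i)) ∧
    2 * n₁ + n₂ + n₃ - 2 ≤ ramseyCycles ![2 * n₁, 2 * n₂, 2 * n₃] := by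
  refine ⟨exists_coloring_of_le (by omega) (by omega) (by omega) le_rfl, ?_⟩
  have hlen : ![2 * n₁, 2 * n₂, 2 * n₃] = fun i ↦ 2 * ![n₁, n₂, n₃] i := by
    ext i
    fin_cases i <;> rfl
  rw [hlen, ramseyCycles]
  refine le_csInf (exists_arrowsCycles_two_mul _ fun i ↦ ?_) fun N hN ↦ ?_
  · fin_cases i
    exacts [h2.trans (h32.trans h21), h2.trans h32, h2]
  · by_contra hlt
    obtain ⟨c, hc⟩ := exists_coloring_of_le (n₁ := n₁) (n₂ := n₂) (n₃ := n₃) (N := N)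
      (by omega) (by omega) (by omega) (by omega)
    obtain ⟨i, hi⟩ := hN c
    exact hc i hi
end

section
/- Let α₁ ≥ α₂ ≥ α₃ > 0 be real numbers. For every real δ > 0 there exists an integer n₀ such that for all integers n ≥ n₀ one has (2α₁+α₂+α₃−δ)n ≤ R(C_{2⌊α₁n⌋}, C_{2⌊α₂n⌋}, C_{2⌊α₃n⌋}) ≤ (2α₁+α₂+α₃+δ)n. -/
open Finset SzemerediRegularity in
/-- The density of a pair is at most slightly larger than the mean density of the pairs of
parts of nearly equitable partitions. -/
theorem edgeDensity_le_mean_finpartition {V : Type*} [DecidableEq V] (H : SimpleGraph V)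
    [DecidableRel H.Adj] {A B : Finset V} (P : Finpartition A) (Q : Finpartition B) {m t : ℕ}
    (hm : 0 < m) (hPm : ∀ s ∈ P.parts, m ≤ #s ∧ #s ≤ m + 1)
    (hQm : ∀ s ∈ Q.parts, m ≤ #s ∧ #s ≤ m + 1) (hPt : #P.parts = t) (hQt : #Q.parts = t)
    (ht : 0 < t) :
    (H.edgeDensity A B : ℝ) * ((m : ℝ) / (m + 1)) ^ 2 ≤
      (∑ ab ∈ P.parts ×ˢ Q.parts, (H.edgeDensity ab.1 ab.2 : ℝ)) / t ^ 2 := by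
  have hA : (t : ℝ) * m ≤ #A := by
    rw [← P.sum_card_parts, ← hPt]
    exact_mod_cast card_nsmul_le_sum _ _ _ fun x hx => (hPm x hx).1
  have hB : (t : ℝ) * m ≤ #B := by
    rw [← Q.sum_card_parts, ← hQt]
    exact_mod_cast card_nsmul_le_sum _ _ _ fun x hx => (hQm x hx).1
  have hm' : (0 : ℝ) < m := by exact_mod_cast hm
  have ht' : (0 : ℝ) < t := by exact_mod_cast ht
  have he : (#(H.interedges A B) : ℝ) ≤
      (m + 1) ^ 2 * ∑ ab ∈ P.parts ×ˢ Q.parts, (H.edgeDensity ab.1 ab.2 : ℝ) := by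
    rw [SimpleGraph.interedges, Rel.card_interedges_finpartition _ P Q, Finset.mul_sum]
    push_cast
    refine sum_le_sum fun ab hab => ?_
    rw [mem_product] at hab
    have h1 := hPm _ hab.1
    have h2 := hQm _ hab.2
    have p1 : (0 : ℝ) < #ab.1 := by exact_mod_cast hm.trans_le h1.1
    have p2 : (0 : ℝ) < #ab.2 := by exact_mod_cast hm.trans_le h2.1
    have q1 : (#ab.1 : ℝ) ≤ m + 1 := by exact_mod_cast h1.2
    have q2 : (#ab.2 : ℝ) ≤ m + 1 := by exact_mod_cast h2.2
    rw [SimpleGraph.edgeDensity_def]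
    push_cast
    rw [mul_div_assoc', le_div_iff₀ (by positivity), mul_comm]
    have hc : (0 : ℝ) ≤ #(H.interedges ab.1 ab.2) := by positivity
    have : (#ab.1 : ℝ) * #ab.2 ≤ (m + 1) ^ 2 := by
      rw [sq]; gcongr
    exact mul_le_mul_of_nonneg_right this hc
  rw [SimpleGraph.edgeDensity_def]
  push_cast
  set S := ∑ ab ∈ P.parts ×ˢ Q.parts, (H.edgeDensity ab.1 ab.2 : ℝ)
  have hAB : ((t : ℝ) * m) * (t * m) ≤ #A * #B := by gcongr
  have hS : 0 ≤ S := sum_nonneg fun ab _ => by exact_mod_cast H.edgeDensity_nonneg _ _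
  have hAB0 : (0 : ℝ) < #A * #B := lt_of_lt_of_le (by positivity) hAB
  rw [div_pow, div_mul_div_comm, div_le_div_iff₀ (by positivity) (by positivity)]
  calc (#(H.interedges A B) : ℝ) * m ^ 2 * t ^ 2
      ≤ ((m + 1) ^ 2 * S) * m ^ 2 * t ^ 2 := by gcongr
    _ = S * (((t : ℝ) * m) * (t * m) * (m + 1) ^ 2) := by ring
    _ ≤ S * (#A * #B * (m + 1) ^ 2) := by gcongr

open Finset SzemerediRegularity in
theorem edgeDensity_sq_sub_le_mean_finpartition {V : Type*} [DecidableEq V] (H : SimpleGraph V)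
    [DecidableRel H.Adj] {A B : Finset V} (P : Finpartition A) (Q : Finpartition B) {m t : ℕ}
    (hm : 0 < m) (hPm : ∀ s ∈ P.parts, m ≤ #s ∧ #s ≤ m + 1)
    (hQm : ∀ s ∈ Q.parts, m ≤ #s ∧ #s ≤ m + 1) (hPt : #P.parts = t) (hQt : #Q.parts = t)
    (ht : 0 < t) :
    (H.edgeDensity A B : ℝ) ^ 2 - 4 / m ≤
      (∑ ab ∈ P.parts ×ˢ Q.parts, (H.edgeDensity ab.1 ab.2 : ℝ) ^ 2) / t ^ 2 := by
  have h := edgeDensity_le_mean_finpartition H P Q hm hPm hQm hPt hQt ht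
  have hm' : (0 : ℝ) < m := by exact_mod_cast hm
  have d0 : (0 : ℝ) ≤ H.edgeDensity A B := by exact_mod_cast H.edgeDensity_nonneg _ _
  have d1 : (H.edgeDensity A B : ℝ) ≤ 1 := by exact_mod_cast H.edgeDensity_le_one _ _
  have hcard : (#(P.parts ×ˢ Q.parts) : ℝ) = (t : ℝ) ^ 2 := by
    rw [card_product, hPt, hQt]; push_cast; ring
  have hcs : ((∑ ab ∈ P.parts ×ˢ Q.parts, (H.edgeDensity ab.1 ab.2 : ℝ)) / t ^ 2) ^ 2 ≤
      (∑ ab ∈ P.parts ×ˢ Q.parts, (H.edgeDensity ab.1 ab.2 : ℝ) ^ 2) / t ^ 2 := by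
    rw [← hcard]
    exact sum_div_card_sq_le_sum_sq_div_card
  refine le_trans ?_ hcs
  have hsq := pow_le_pow_left₀ (by positivity) h 2
  refine le_trans ?_ hsq
  set x : ℝ := (m : ℝ) / (m + 1)
  have hx : 1 - 1 / m ≤ x := by
    have : x = 1 - 1 / (m + 1) := by simp only [x]; field_simp; ring
    rw [this]
    gcongr
    linarith
  have hx0 : 0 ≤ x := by positivity
  have hx1 : x ≤ 1 := by simp only [x]; rw [div_le_one (by positivity)]; linarith
  have h4 : 1 - 4 / m ≤ x ^ 4 := by
    have hx4 : 1 - 4 * (1 - x) ≤ x ^ 4 := by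
      nlinarith [sq_nonneg (x - 1), sq_nonneg (x ^ 2 - 1),
        mul_nonneg hx0 (sq_nonneg (x - 1)), mul_nonneg (sq_nonneg x) (sq_nonneg (x - 1))]
    have : (4 : ℝ) / m = 4 * (1 / m) := by ring
    rw [this]; linarith
  have hq : (0:ℝ) ≤ 4 / m := by positivity
  calc (H.edgeDensity A B : ℝ) ^ 2 - 4 / m
      ≤ (H.edgeDensity A B : ℝ) ^ 2 * (1 - 4 / m) := by
        have : (H.edgeDensity A B : ℝ) ^ 2 ≤ 1 := by nlinarith
        nlinarith
    _ ≤ (H.edgeDensity A B : ℝ) ^ 2 * x ^ 4 := by gcongr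
    _ = _ := by ring

open Finset SzemerediRegularity Finpartition in
/-- The increment partition built for `G` decreases the energy of any other graph by very
little. -/
theorem energy_sub_le_energy_increment {V : Type*} [Fintype V] [DecidableEq V] [Nonempty V]
    {P : Finpartition (univ : Finset V)} (hP : P.IsEquipartition) (G H : SimpleGraph V)
    [DecidableRel G.Adj] [DecidableRel H.Adj] {ε : ℝ} (hPpos : 0 < #P.parts)
    (hPε : 100 ≤ 4 ^ #P.parts * ε ^ 5) (hPα : #P.parts * 16 ^ #P.parts ≤ Fintype.card V)
    (hPG : ¬P.IsUniform G ε) (hε₀ : 0 < ε) :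
    (P.energy H : ℝ) - ε ^ 5 / 25 ≤ (increment hP G ε).energy H := by
  set m := Fintype.card V / stepBound #P.parts with hmdef
  have hm : 0 < m := m_pos hPα
  have hmε : 4 / (m : ℝ) ≤ ε ^ 5 / 25 := by
    have := hundred_div_ε_pow_five_le_m hPα hPε
    have hm' : (0 : ℝ) < m := by exact_mod_cast hm
    rw [div_le_iff₀ (by positivity)] at this
    rw [div_le_div_iff₀ hm' (by norm_num)]
    linarith
  let D : {x // x ∈ P.parts.offDiag} → Finset (Finset V × Finset V) := fun x =>
    (chunk hP G ε (mem_offDiag.1 x.2).1).parts ×ˢ (chunk hP G ε (mem_offDiag.1 x.2).2.1).parts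
  have hDsub : P.parts.offDiag.attach.biUnion D ⊆ (increment hP G ε).parts.offDiag := by
    rintro ⟨Ui, Vj⟩
    simp only [D, increment, mem_offDiag, bind_parts, mem_biUnion, Prod.exists,
      mem_product, mem_attach, true_and, Subtype.exists, and_imp,
      mem_offDiag, forall_exists_index, Ne]
    refine fun U V hUV hUi hVj => ⟨⟨_, hUV.1, hUi⟩, ⟨_, hUV.2.1, hVj⟩, ?_⟩
    rintro rfl
    obtain ⟨i, hi⟩ := nonempty_of_mem_parts _ hUi
    exact hUV.2.2 (P.disjoint.elim_finset hUV.1 hUV.2.1 i (Finpartition.le _ hUi hi) <|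
      Finpartition.le _ hVj hi)
  have hDdisj : (P.parts.offDiag.attach : Set {x // x ∈ P.parts.offDiag}).PairwiseDisjoint D := by
    simp +unfoldPartialApp only [D, Set.PairwiseDisjoint,
      Function.onFun, Finset.disjoint_left, mem_product]
    rintro ⟨⟨s₁, s₂⟩, hs⟩ _ ⟨⟨t₁, t₂⟩, ht⟩ _ hst ⟨u, v⟩ huv₁ huv₂
    rw [mem_offDiag] at hs ht
    obtain ⟨a, ha⟩ := Finpartition.nonempty_of_mem_parts _ huv₁.1
    obtain ⟨b, hb⟩ := Finpartition.nonempty_of_mem_parts _ huv₁.2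
    exact hst <| Subtype.ext <| Prod.ext
      (P.disjoint.elim_finset hs.1 ht.1 a (Finpartition.le _ huv₁.1 ha) <|
        Finpartition.le _ huv₂.1 ha) <|
          P.disjoint.elim_finset hs.2.1 ht.2.1 b (Finpartition.le _ huv₁.2 hb) <|
            Finpartition.le _ huv₂.2 hb
  have hpair : ∀ x : {x // x ∈ P.parts.offDiag},
      (H.edgeDensity x.1.1 x.1.2 : ℝ) ^ 2 - ε ^ 5 / 25 ≤
        (∑ i ∈ D x, (H.edgeDensity i.1 i.2 : ℝ) ^ 2) / 16 ^ #P.parts := by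
    intro x
    have h := edgeDensity_sq_sub_le_mean_finpartition H
      (chunk hP G ε (mem_offDiag.1 x.2).1) (chunk hP G ε (mem_offDiag.1 x.2).2.1) hm
      (fun s hs => ⟨m_le_card_of_mem_chunk_parts hs, card_le_m_add_one_of_mem_chunk_parts hs⟩)
      (fun s hs => ⟨m_le_card_of_mem_chunk_parts hs, card_le_m_add_one_of_mem_chunk_parts hs⟩)
      (card_chunk hm.ne') (card_chunk hm.ne') (by positivity)
    have h16 : (((4 ^ #P.parts : ℕ) : ℝ)) ^ 2 = 16 ^ #P.parts := by
      push_cast; rw [← pow_mul, mul_comm, pow_mul]; norm_num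
    rw [h16] at h
    linarith
  have hPpos' : (0 : ℝ) < #P.parts := by exact_mod_cast hPpos
  calc (P.energy H : ℝ) - ε ^ 5 / 25
      = (∑ x ∈ P.parts.offDiag, (H.edgeDensity x.1 x.2 : ℝ) ^ 2 -
          #P.parts ^ 2 * (ε ^ 5 / 25) : ℝ) / #P.parts ^ 2 := by
        rw [coe_energy, sub_div, mul_div_cancel_left₀]; positivity
    _ ≤ (∑ x ∈ P.parts.offDiag.attach, (∑ i ∈ D x,
          (H.edgeDensity i.1 i.2 : ℝ) ^ 2) / 16 ^ #P.parts) / #P.parts ^ 2 := by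
        gcongr
        refine le_trans ?_ (sum_le_sum fun i _ => hpair i)
        rw [sum_sub_distrib, sum_attach P.parts.offDiag
          (fun x => (H.edgeDensity x.1 x.2 : ℝ) ^ 2), sum_const, nsmul_eq_mul, card_attach]
        gcongr
        rw [offDiag_card, sq]
        exact_mod_cast Nat.sub_le _ _
    _ = (∑ x ∈ P.parts.offDiag.attach, ∑ i ∈ D x,
          (H.edgeDensity i.1 i.2 : ℝ) ^ 2) / #(increment hP G ε).parts ^ 2 := by
        rw [card_increment hPα hPG, coe_stepBound, mul_pow, pow_right_comm,
          div_mul_eq_div_div_swap, ← sum_div]; norm_num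
    _ ≤ _ := by
        rw [coe_energy]
        gcongr
        rw [← sum_biUnion hDdisj]
        exact sum_le_sum_of_subset_of_nonneg hDsub fun i _ _ ↦ sq_nonneg _

open Finset SzemerediRegularity in
/-- Szemerédi's regularity lemma for three graphs on the same vertex set. -/
theorem exists_bound_regularity_three {ε : ℝ} (hε : 0 < ε) (hε₁ : ε ≤ 1) (l : ℕ) :
    ∃ M : ℕ, ∀ (V : Type) [Fintype V] [DecidableEq V] (G : Fin 3 → SimpleGraph V)
      [∀ i, DecidableRel (G i).Adj], M ≤ Fintype.card V →
      ∃ P : Finpartition (univ : Finset V), P.IsEquipartition ∧ l ≤ #P.parts ∧ #P.parts ≤ M ∧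
        ∀ i, P.IsUniform (G i) ε := by
  set t := initialBound ε l with ht
  set s := ⌊24 / ε ^ 5⌋₊ with hs
  set B := stepBound^[s + 1] t with hB
  refine ⟨B * 16 ^ B, fun V _ _ G _ hV => ?_⟩
  have htB : t ≤ B := by
    rw [hB]
    exact Function.id_le_iterate_of_id_le le_stepBound _ _
  have hBM : B ≤ B * 16 ^ B := Nat.le_mul_of_pos_right _ (by positivity)
  have htV : t ≤ #(univ : Finset V) := by
    rw [card_univ]; exact (htB.trans hBM).trans hV
  have hne : Nonempty V := by
    rw [← Fintype.card_pos_iff]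
    exact (initialBound_pos ε l).trans_le (by rwa [← card_univ])
  obtain ⟨dum, hdum₁, hdum₂⟩ :=
    Finpartition.exists_equipartition_card_eq (univ : Finset V) (initialBound_pos ε l).ne' htV
  suffices h : ∀ i, i ≤ s + 1 → ∃ P : Finpartition (univ : Finset V), P.IsEquipartition ∧
      t ≤ #P.parts ∧ #P.parts ≤ stepBound^[i] t ∧
      ((∀ j, P.IsUniform (G j) ε) ∨ ε ^ 5 / 8 * i ≤ ∑ j, (P.energy (G j) : ℝ)) by
    obtain ⟨P, hP₁, hP₂, hP₃, hP₄⟩ := h (s + 1) le_rfl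
    refine ⟨P, hP₁, (le_initialBound _ _).trans hP₂, hP₃.trans hBM,
      hP₄.resolve_right fun hE => ?_⟩
    have h3 : ∑ j, (P.energy (G j) : ℝ) ≤ 3 := by
      have : ∑ j : Fin 3, (P.energy (G j) : ℝ) ≤ ∑ j : Fin 3, (1 : ℝ) :=
        sum_le_sum fun j _ => by exact_mod_cast P.energy_le_one (G j)
      simpa using this
    have h4 : 24 / ε ^ 5 < s + 1 := Nat.lt_floor_add_one _
    rw [div_lt_iff₀ (by positivity)] at h4
    rw [Nat.cast_succ] at hE
    nlinarith
  intro i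
  induction i with
  | zero =>
    intro _
    refine ⟨dum, hdum₁, hdum₂.ge, hdum₂.le, Or.inr ?_⟩
    rw [Nat.cast_zero, mul_zero]
    exact sum_nonneg fun j _ => by exact_mod_cast dum.energy_nonneg (G j)
  | succ i ih =>
    intro hi
    obtain ⟨P, hP₁, hP₂, hP₃, hP₄⟩ := ih (by omega)
    by_cases huniform : ∀ j, P.IsUniform (G j) ε
    · refine ⟨P, hP₁, hP₂, ?_, Or.inl huniform⟩
      rw [Function.iterate_succ_apply']
      exact hP₃.trans (le_stepBound _)
    replace hP₄ := hP₄.resolve_left huniform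
    push Not at huniform
    obtain ⟨j, hj⟩ := huniform
    have hεl' : 100 ≤ 4 ^ #P.parts * ε ^ 5 :=
      (hundred_lt_pow_initialBound_mul hε l).le.trans
        (mul_le_mul_of_nonneg_right (pow_right_mono₀ (by simp) hP₂) <| by positivity)
    have hsize : #P.parts ≤ B :=
      hP₃.trans (Function.monotone_iterate_of_id_le le_stepBound (by omega) _)
    have hPα : #P.parts * 16 ^ #P.parts ≤ Fintype.card V :=
      (Nat.mul_le_mul hsize (Nat.pow_le_pow_right (by simp) hsize)).trans hV
    have h7 : 7 ≤ #P.parts := (seven_le_initialBound ε l).trans hP₂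
    refine ⟨increment hP₁ (G j) ε, increment_isEquipartition hP₁ (G j) ε, ?_, ?_, Or.inr ?_⟩
    · rw [card_increment hPα hj]
      exact hP₂.trans (le_stepBound _)
    · rw [card_increment hPα hj, Function.iterate_succ_apply']
      exact stepBound_mono hP₃
    · have hinc := energy_increment hP₁ h7 hεl' hPα hj hε.le hε₁
      have hoth : ∀ j', (P.energy (G j') : ℝ) - ε ^ 5 / 25 ≤
          (increment hP₁ (G j) ε).energy (G j') := fun j' =>
        energy_sub_le_energy_increment hP₁ (G j) (G j') (by omega) hεl' hPα hj hε
      have h5 : 0 < ε ^ 5 := by positivity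
      have h0 := hoth 0
      have h1 := hoth 1
      have h2 := hoth 2
      rw [Fin.sum_univ_three] at hP₄ ⊢
      rw [Nat.cast_succ]
      fin_cases j <;> simp only [Fin.zero_eta, Fin.mk_one, Fin.reduceFinMk] at * <;> linarith

/-- Three families of components `C₁, C₂, C₃` on a finite set `s` with weights `H₁, H₂, H₃`
in `{0, 1, 2}` such that each pair of points is covered in some color (twice a fractional vertex
cover), and each component of color `i` has weight at most `Aᵢ ≤ M`. -/
structure CoverSystem {V β : Type*} [DecidableEq β] (s : Finset V) (C₁ C₂ C₃ : V → β)
    (H₁ H₂ H₃ : V → ℕ) (A₁ A₂ A₃ M : ℕ) : Prop where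
  pair : ∀ x ∈ s, ∀ y ∈ s, (C₁ x = C₁ y ∧ 2 ≤ H₁ x + H₁ y) ∨ (C₂ x = C₂ y ∧ 2 ≤ H₂ x + H₂ y) ∨
    (C₃ x = C₃ y ∧ 2 ≤ H₃ x + H₃ y)
  le₁ : ∀ x ∈ s, H₁ x ≤ 2
  le₂ : ∀ x ∈ s, H₂ x ≤ 2
  le₃ : ∀ x ∈ s, H₃ x ≤ 2
  sum₁ : ∀ c, ∑ x ∈ s, (if C₁ x = c then H₁ x else 0) ≤ A₁
  sum₂ : ∀ c, ∑ x ∈ s, (if C₂ x = c then H₂ x else 0) ≤ A₂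
  sum₃ : ∀ c, ∑ x ∈ s, (if C₃ x = c then H₃ x else 0) ≤ A₃
  leM₁ : A₁ ≤ M
  leM₂ : A₂ ≤ M
  leM₃ : A₃ ≤ M

namespace CoverSystem

variable {V β : Type*} [DecidableEq β] {s : Finset V} {C₁ C₂ C₃ : V → β}
    {H₁ H₂ H₃ : V → ℕ} {A₁ A₂ A₃ M : ℕ}

theorem swap₁₂ (h : CoverSystem s C₁ C₂ C₃ H₁ H₂ H₃ A₁ A₂ A₃ M) :
    CoverSystem s C₂ C₁ C₃ H₂ H₁ H₃ A₂ A₁ A₃ M :=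
  ⟨fun x hx y hy => by rcases h.pair x hx y hy with h | h | h <;> tauto, h.le₂, h.le₁, h.le₃,
    h.sum₂, h.sum₁, h.sum₃, h.leM₂, h.leM₁, h.leM₃⟩

theorem swap₂₃ (h : CoverSystem s C₁ C₂ C₃ H₁ H₂ H₃ A₁ A₂ A₃ M) :
    CoverSystem s C₁ C₃ C₂ H₁ H₃ H₂ A₁ A₃ A₂ M :=
  ⟨fun x hx y hy => by rcases h.pair x hx y hy with h | h | h <;> tauto, h.le₁, h.le₃, h.le₂,
    h.sum₁, h.sum₃, h.sum₂, h.leM₁, h.leM₃, h.leM₂⟩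

theorem card_le_of_pointwise (h : CoverSystem s C₁ C₂ C₃ H₁ H₂ H₃ A₁ A₂ A₃ M) (a b c : β)
    (e : V → ℕ) (he : ∑ x ∈ s, e x ≤ M)
    (hp : ∀ x ∈ s, 2 ≤ (if C₁ x = a then H₁ x else 0) + (if C₂ x = b then H₂ x else 0) +
      (if C₃ x = c then H₃ x else 0) + e x) :
    2 * s.card ≤ A₁ + A₂ + A₃ + M := by
  have h1 := h.sum₁ a
  have h2 := h.sum₂ b
  have h3 := h.sum₃ c
  have := Finset.sum_le_sum hp
  simp only [Finset.sum_add_distrib, Finset.sum_const, smul_eq_mul] at this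
  omega

/-- Variants of `card_le_of_pointwise` in which the extra weight is that of a component. -/
theorem card_le_of_pointwise₁ (h : CoverSystem s C₁ C₂ C₃ H₁ H₂ H₃ A₁ A₂ A₃ M) (a b c : β)
    (hp : ∀ x ∈ s, 2 ≤ (if C₁ x = a then H₁ x else 0) + (if C₂ x = b then H₂ x else 0) +
      (if C₃ x = c then H₃ x else 0) + (if C₁ x = a then H₁ x else 0)) :
    2 * s.card ≤ A₁ + A₂ + A₃ + M :=
  h.card_le_of_pointwise a b c _ ((h.sum₁ a).trans h.leM₁) hp

theorem card_le_of_pointwise₂ (h : CoverSystem s C₁ C₂ C₃ H₁ H₂ H₃ A₁ A₂ A₃ M) (a b c : β)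
    (hp : ∀ x ∈ s, 2 ≤ (if C₁ x = a then H₁ x else 0) + (if C₂ x = b then H₂ x else 0) +
      (if C₃ x = c then H₃ x else 0) + (if C₂ x = b then H₂ x else 0)) :
    2 * s.card ≤ A₁ + A₂ + A₃ + M :=
  h.card_le_of_pointwise a b c _ ((h.sum₂ b).trans h.leM₂) hp

theorem card_le_of_pointwise₃ (h : CoverSystem s C₁ C₂ C₃ H₁ H₂ H₃ A₁ A₂ A₃ M) (a b c : β)
    (hp : ∀ x ∈ s, 2 ≤ (if C₁ x = a then H₁ x else 0) + (if C₂ x = b then H₂ x else 0) +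
      (if C₃ x = c then H₃ x else 0) + (if C₃ x = c then H₃ x else 0)) :
    2 * s.card ≤ A₁ + A₂ + A₃ + M :=
  h.card_le_of_pointwise a b c _ ((h.sum₃ c).trans h.leM₃) hp

/-- The bound when some part of the third color outside its main component is badly covered
by the first two colors. -/
theorem card_le_of_majority_aux (h : CoverSystem s C₁ C₂ C₃ H₁ H₂ H₃ A₁ A₂ A₃ M) {a b c : β}
    (hmaj : ∀ x ∈ s, (C₁ x = a ∧ C₂ x = b) ∨ (C₁ x = a ∧ C₃ x = c) ∨ (C₂ x = b ∧ C₃ x = c))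
    {x y : V} (hx : x ∈ s) (hy : y ∈ s) (hxc : C₃ x ≠ c) (hyc : C₃ y ≠ c) (hx₂ : H₂ x = 0)
    (hx₁ : H₁ x ≤ 1) (hy₁ : H₁ y = 0) (hy₂ : H₂ y ≤ 1) :
    2 * s.card ≤ A₁ + A₂ + A₃ + M := by
  have hpair := h.pair
  have hsame : C₃ x = C₃ y ∧ 2 ≤ H₃ x + H₃ y := by
    rcases hpair x hx y hy with h' | h' | h' <;> grind
  have hout : ∀ v ∈ s, C₃ v = c → 2 ≤ (if C₁ v = a then H₁ v else 0) +
      (if C₂ v = b then H₂ v else 0) := by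
    intro v hv hvc
    have h1 := hpair v hv x hx
    have h2 := hpair v hv y hy
    have h3 := hmaj v hv
    have h4 := hmaj x hx
    have h5 := hmaj y hy
    grind
  have hin : ∀ v ∈ s, C₃ v ≠ c → C₁ v = a ∧ C₂ v = b := by
    intro v hv hvc
    have h3 := hmaj v hv
    grind
  have hdef : ∀ v ∈ s, C₃ v ≠ c → H₁ v + H₂ v ≤ 1 → C₃ v = C₃ x := by
    intro v hv hvc hd
    have h1 := hpair v hv x hx
    have h2 := hpair v hv y hy
    grind
  by_cases hd : ∃ d ∈ s, C₃ d ≠ c ∧ H₁ d = 0 ∧ H₂ d = 0 ∧ H₃ d ≤ 1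
  · obtain ⟨d, hds, hdc, hd1, hd2, hd3⟩ := hd
    refine h.card_le_of_pointwise₃ a b (C₃ x) fun v hv => ?_
    by_cases hvc : C₃ v = c
    · have := hout v hv hvc
      omega
    · have h1 := hpair v hv d hds
      have h2 := hdef v hv hvc
      have h3 := hin v hv hvc
      grind
  push Not at hd
  by_cases hp : ∃ p ∈ s, C₃ p ≠ c ∧ H₁ p = 1 ∧ H₂ p = 0 ∧ H₃ p = 0
  · obtain ⟨p, hps, hpc, hp1, hp2, hp3⟩ := hp
    refine h.card_le_of_pointwise₁ a b (C₃ x) fun v hv => ?_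
    by_cases hvc : C₃ v = c
    · have := hout v hv hvc
      omega
    · have h1 := hpair v hv p hps
      have h2 := hdef v hv hvc
      have h3 := hin v hv hvc
      have h4 := hd v hv hvc
      grind
  · push Not at hp
    refine h.card_le_of_pointwise₂ a b (C₃ x) fun v hv => ?_
    by_cases hvc : C₃ v = c
    · have := hout v hv hvc
      omega
    · have h1 := hp v hv hvc
      have h2 := hdef v hv hvc
      have h3 := hin v hv hvc
      have h4 := hd v hv hvc
      grind

theorem card_le_of_majority (h : CoverSystem s C₁ C₂ C₃ H₁ H₂ H₃ A₁ A₂ A₃ M) {a b c : β}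
    (hmaj : ∀ x ∈ s, (C₁ x = a ∧ C₂ x = b) ∨ (C₁ x = a ∧ C₃ x = c) ∨ (C₂ x = b ∧ C₃ x = c)) :
    2 * s.card ≤ A₁ + A₂ + A₃ + M := by
  have hpair := h.pair
  by_cases h3 : ∃ x ∈ s, ∃ y ∈ s, C₃ x ≠ c ∧ C₃ y ≠ c ∧ H₂ x = 0 ∧ H₁ x ≤ 1 ∧ H₁ y = 0 ∧ H₂ y ≤ 1
  · obtain ⟨x, hx, y, hy, h1, h2, h3, h4, h5, h6⟩ := h3
    exact h.card_le_of_majority_aux hmaj hx hy h1 h2 h3 h4 h5 h6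
  by_cases h2 : ∃ x ∈ s, ∃ y ∈ s, C₂ x ≠ b ∧ C₂ y ≠ b ∧ H₃ x = 0 ∧ H₁ x ≤ 1 ∧ H₁ y = 0 ∧ H₃ y ≤ 1
  · obtain ⟨x, hx, y, hy, h1, h2, h3, h4, h5, h6⟩ := h2
    have := h.swap₂₃.card_le_of_majority_aux (fun v hv => by have := hmaj v hv; tauto)
      hx hy h1 h2 h3 h4 h5 h6
    omega
  by_cases h1 : ∃ x ∈ s, ∃ y ∈ s, C₁ x ≠ a ∧ C₁ y ≠ a ∧ H₃ x = 0 ∧ H₂ x ≤ 1 ∧ H₂ y = 0 ∧ H₃ y ≤ 1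
  · obtain ⟨x, hx, y, hy, h1, h2, h3, h4, h5, h6⟩ := h1
    have := h.swap₁₂.swap₂₃.card_le_of_majority_aux (fun v hv => by have := hmaj v hv; tauto)
      hx hy h1 h2 h3 h4 h5 h6
    omega
  push Not at h1 h2 h3
  by_cases e1 : ∃ p ∈ s, C₁ p = a ∧ H₁ p = 1 ∧ (if C₂ p = b then H₂ p else 0) = 0 ∧
      (if C₃ p = c then H₃ p else 0) = 0
  · obtain ⟨p, hp, q1, q2, q3, q4⟩ := e1
    refine h.card_le_of_pointwise₁ a b c fun v hv => ?_
    have r1 := hpair v hv p hp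
    have r2 := hpair v hv v hv
    have r3 := hmaj v hv
    have r4 := hmaj p hp
    have r5 := h1 v hv v hv
    have r6 := h2 v hv v hv
    have r7 := h3 v hv v hv
    have r8 := h2 v hv p hp
    have r9 := h2 p hp v hv
    have r10 := h3 v hv p hp
    have r11 := h3 p hp v hv
    clear hpair hmaj h1 h2 h3
    grind
  push Not at e1
  by_cases e2 : ∃ p ∈ s, C₂ p = b ∧ H₂ p = 1 ∧ (if C₁ p = a then H₁ p else 0) = 0 ∧
      (if C₃ p = c then H₃ p else 0) = 0
  · obtain ⟨p, hp, q1, q2, q3, q4⟩ := e2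
    refine h.card_le_of_pointwise₂ a b c fun v hv => ?_
    have r1 := hpair v hv p hp
    have r2 := hpair v hv v hv
    have r3 := hmaj v hv
    have r4 := hmaj p hp
    have r5 := h1 v hv v hv
    have r6 := h2 v hv v hv
    have r7 := h3 v hv v hv
    have r8 := h1 v hv p hp
    have r9 := h1 p hp v hv
    have r12 := e1 v hv
    clear hpair hmaj h1 h2 h3 e1
    grind
  push Not at e2
  refine h.card_le_of_pointwise₃ a b c fun v hv => ?_
  have r2 := hpair v hv v hv
  have r3 := hmaj v hv
  have r5 := h1 v hv v hv
  have r6 := h2 v hv v hv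
  have r7 := h3 v hv v hv
  have r8 := e1 v hv
  have r9 := e2 v hv
  clear hpair hmaj h1 h2 h3 e1 e2
  grind

end CoverSystem

namespace CoverSystem

variable {V β : Type*} [DecidableEq β] {s : Finset V} {C₁ C₂ C₃ : V → β}
    {H₁ H₂ H₃ : V → ℕ} {A₁ A₂ A₃ M : ℕ}

/-- The case of a spanning component in which the points of weight zero share their second
component. -/
theorem card_le_of_spanning_aux (h : CoverSystem s C₁ C₂ C₃ H₁ H₂ H₃ A₁ A₂ A₃ M) {a b : β}
    (ha : ∀ x ∈ s, C₁ x = a) {t : V} (ht : t ∈ s) (ht₁ : H₁ t = 0)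
    (hb : ∀ x ∈ s, H₁ x = 0 → C₂ x = b) :
    2 * s.card ≤ A₁ + A₂ + A₃ + M := by
  have hpair := h.pair
  by_cases hc : ∀ x ∈ s, H₁ x = 0 → C₃ x = C₃ t
  · by_cases h2 : ∃ p ∈ s, H₁ p = 0 ∧ H₂ p = 1 ∧ H₃ p = 0
    · obtain ⟨p, hp, q1, q2, q3⟩ := h2
      refine h.card_le_of_pointwise₂ a b (C₃ t) fun v hv => ?_
      have r1 := hpair v hv p hp
      have r2 := hpair v hv v hv
      have r3 := hb v hv
      have r4 := hc v hv
      have r5 := hb p hp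
      have r6 := ha v hv
      grind
    push Not at h2
    by_cases h3 : ∃ p ∈ s, H₁ p = 0 ∧ H₂ p = 0 ∧ H₃ p = 1
    · obtain ⟨p, hp, q1, q2, q3⟩ := h3
      refine h.card_le_of_pointwise₃ a b (C₃ t) fun v hv => ?_
      have r1 := hpair v hv p hp
      have r2 := hpair v hv v hv
      have r3 := hb v hv
      have r4 := hc v hv
      have r5 := hc p hp
      have r6 := ha v hv
      grind
    push Not at h3
    refine h.card_le_of_pointwise₁ a b (C₃ t) fun v hv => ?_
    have r2 := hpair v hv v hv
    have r3 := hb v hv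
    have r4 := hc v hv
    have r5 := h2 v hv
    have r6 := ha v hv
    have r7 := h3 v hv
    grind
  push Not at hc
  obtain ⟨u, hu, hu₁, hu₃⟩ := hc
  have hb' : ∀ x ∈ s, H₁ x ≤ 1 → C₂ x = b := by
    intro x hx hx₁
    have r1 := hpair x hx t ht
    have r2 := hpair x hx u hu
    have r3 := hb t ht
    have r4 := hb u hu
    grind
  have key : ∀ y ∈ s, H₁ y = 0 → (∀ x ∈ s, H₁ x + H₂ x ≤ 1 → C₃ x = C₃ y) →
      (∀ x ∈ s, H₁ x = 0 → H₂ x = 1 → 1 ≤ H₃ x) →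
      (∀ x ∈ s, H₁ x = 0 → H₂ x = 0 → 2 ≤ H₃ x) → 2 * s.card ≤ A₁ + A₂ + A₃ + M := by
    intro y hy hy₁ h1 h2 h3
    refine h.card_le_of_pointwise₁ a b (C₃ y) fun v hv => ?_
    have r2 := hpair v hv v hv
    have r3 := hb' v hv
    have r4 := h1 v hv
    have r5 := h2 v hv
    have r6 := ha v hv
    have r7 := h3 v hv
    grind
  by_cases hX : ∃ x ∈ s, H₁ x = 0 ∧ H₂ x = 0
  · obtain ⟨x₀, hx₀, hx₁, hx₂⟩ := hX
    have hC : ∀ v ∈ s, H₁ v + H₂ v ≤ 1 → C₃ v = C₃ x₀ := by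
      intro v hv hd
      have r1 := hpair v hv x₀ hx₀
      grind
    by_cases hx₃ : ∃ x ∈ s, H₁ x = 0 ∧ H₂ x = 0 ∧ H₃ x ≤ 1
    · obtain ⟨x, hx, q1, q2, q3⟩ := hx₃
      refine h.card_le_of_pointwise₃ a b (C₃ x₀) fun v hv => ?_
      have r1 := hpair v hv x hx
      have r2 := hpair v hv v hv
      have r3 := hb' v hv
      have r4 := hC v hv
      have r5 := hC x hx
      have r6 := ha v hv
      grind
    push Not at hx₃
    by_cases hy : ∃ y ∈ s, H₁ y = 0 ∧ H₂ y = 1 ∧ H₃ y = 0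
    · obtain ⟨y, hy, q1, q2, q3⟩ := hy
      refine h.card_le_of_pointwise₂ a b (C₃ x₀) fun v hv => ?_
      have r1 := hpair v hv y hy
      have r2 := hpair v hv v hv
      have r3 := hb' v hv
      have r4 := hC v hv
      have r5 := hx₃ v hv
      have r6 := ha v hv
      grind
    push Not at hy
    exact key x₀ hx₀ hx₁ hC (fun x hx q1 q2 => by have := hy x hx q1 q2; omega)
      (fun x hx q1 q2 => hx₃ x hx q1 q2)
  push Not at hX
  by_cases hY : ∃ y ∈ s, H₁ y = 0 ∧ H₂ y = 1
  · obtain ⟨y₀, hy₀, hy₁, hy₂⟩ := hY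
    by_cases hX' : ∃ x ∈ s, H₁ x = 1 ∧ H₂ x = 0
    · obtain ⟨x₀, hx₀, hx₁, hx₂⟩ := hX'
      have hC : ∀ v ∈ s, H₁ v + H₂ v ≤ 1 → C₃ v = C₃ y₀ := by
        intro v hv hd
        have r1 := hpair v hv x₀ hx₀
        have r2 := hpair v hv y₀ hy₀
        have r3 := hpair x₀ hx₀ y₀ hy₀
        have r4 := hX v hv
        grind
      by_cases hy : ∃ y ∈ s, H₁ y = 0 ∧ H₂ y = 1 ∧ H₃ y = 0
      · obtain ⟨y, hy, q1, q2, q3⟩ := hy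
        refine h.card_le_of_pointwise₂ a b (C₃ y₀) fun v hv => ?_
        have r1 := hpair v hv y hy
        have r2 := hpair v hv v hv
        have r3 := hb' v hv
        have r4 := hC v hv
        have r5 := hX v hv
        have r6 := ha v hv
        grind
      push Not at hy
      exact key y₀ hy₀ hy₁ hC (fun x hx q1 q2 => by have := hy x hx q1 q2; omega)
        (fun x hx q1 q2 => absurd q2 (hX x hx q1))
    push Not at hX'
    refine h.card_le_of_pointwise₂ a b (C₃ t) fun v hv => ?_
    have r3 := hb' v hv
    have r4 := hX' v hv
    have r5 := hX v hv
    have r6 := ha v hv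
    grind
  push Not at hY
  refine h.card_le_of_pointwise₁ a b (C₃ t) fun v hv => ?_
  have r3 := hb' v hv
  have r4 := hY v hv
  have r5 := hX v hv
  have r6 := ha v hv
  grind

theorem card_le_of_spanning (h : CoverSystem s C₁ C₂ C₃ H₁ H₂ H₃ A₁ A₂ A₃ M) {a : β}
    (ha : ∀ x ∈ s, C₁ x = a) : 2 * s.card ≤ A₁ + A₂ + A₃ + M := by
  by_cases hT : ∃ t ∈ s, H₁ t = 0
  · obtain ⟨t, ht, ht₁⟩ := hT
    by_cases hb : ∀ x ∈ s, H₁ x = 0 → C₂ x = C₂ t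
    · exact h.card_le_of_spanning_aux ha ht ht₁ hb
    · have hc : ∀ x ∈ s, H₁ x = 0 → C₃ x = C₃ t := by
        push Not at hb
        obtain ⟨u, hu, hu₁, hu₂⟩ := hb
        intro x hx hx₁
        have r1 := h.pair x hx t ht
        have r2 := h.pair x hx u hu
        have r3 := h.pair t ht u hu
        grind
      have := h.swap₂₃.card_le_of_spanning_aux ha ht ht₁ hc
      omega
  · push Not at hT
    by_cases hs : s.Nonempty
    · obtain ⟨t, ht⟩ := hs
      refine h.card_le_of_pointwise₁ a (C₂ t) (C₃ t) fun v hv => ?_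
      have r1 := hT v hv
      have r2 := ha v hv
      grind
    · rw [Finset.not_nonempty_iff_eq_empty] at hs
      simp [hs]

end CoverSystem

namespace CoverSystem

variable {V β : Type*} [DecidableEq β] {s : Finset V} {C₁ C₂ C₃ : V → β}
    {H₁ H₂ H₃ : V → ℕ} {A₁ A₂ A₃ M : ℕ}

/-- A lower bound for the weight of a component containing two disjoint parts. -/
theorem add_le_of_parts {C : V → β} {H : V → ℕ} {A : ℕ} {a : β}
    (h : ∑ x ∈ s, (if C x = a then H x else 0) ≤ A) {P Q : Finset V} (hP : P ⊆ s) (hQ : Q ⊆ s)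
    (hd : Disjoint P Q) (hPa : ∀ x ∈ P, C x = a) (hQa : ∀ x ∈ Q, C x = a) {q : ℕ}
    (hq : ∀ x ∈ Q, q ≤ H x) : ∑ x ∈ P, H x + q * Q.card ≤ A := by
  classical
  refine le_trans ?_ h
  refine le_trans ?_ (Finset.sum_le_sum_of_subset (Finset.union_subset hP hQ))
  rw [Finset.sum_union hd, Finset.sum_congr rfl (fun x hx => if_pos (hPa x hx)),
    Finset.sum_congr rfl (fun x hx => if_pos (hQa x hx)), mul_comm, ← smul_eq_mul]
  exact Nat.add_le_add_left (Finset.card_nsmul_le_sum _ _ _ hq) _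

theorem card_le_of_fano_aux (h : CoverSystem s C₁ C₂ C₃ H₁ H₂ H₃ A₁ A₂ A₃ M) {a a' b b' c c' : β}
    (ha : a ≠ a') (hb : b ≠ b') (hc : c ≠ c')
    (hQ : ∀ x ∈ s, (C₁ x = a ∧ C₂ x = b ∧ C₃ x = c) ∨ (C₁ x = a ∧ C₂ x = b' ∧ C₃ x = c') ∨
      (C₁ x = a' ∧ C₂ x = b ∧ C₃ x = c') ∨ (C₁ x = a' ∧ C₂ x = b' ∧ C₃ x = c))
    (h₂ : (s.filter fun x => C₁ x = a ∧ C₂ x = b').card ≤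
      (s.filter fun x => C₁ x = a ∧ C₂ x = b).card)
    (h₃ : (s.filter fun x => C₁ x = a' ∧ C₂ x = b).card ≤
      (s.filter fun x => C₁ x = a ∧ C₂ x = b).card)
    (h₄ : (s.filter fun x => C₁ x = a' ∧ C₂ x = b').card ≤
      (s.filter fun x => C₁ x = a ∧ C₂ x = b).card) :
    2 * s.card ≤ A₁ + A₂ + A₃ + M := by
  have hpair := h.pair
  have hle₁ := h.le₁
  have hle₂ := h.le₂
  have hle₃ := h.le₃
  set Q₁ := s.filter fun x => C₁ x = a ∧ C₂ x = b with hQ₁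
  set Q₂ := s.filter fun x => C₁ x = a ∧ C₂ x = b' with hQ₂
  set Q₃ := s.filter fun x => C₁ x = a' ∧ C₂ x = b with hQ₃
  set Q₄ := s.filter fun x => C₁ x = a' ∧ C₂ x = b' with hQ₄
  have m₁ : ∀ x ∈ Q₁, x ∈ s ∧ C₁ x = a ∧ C₂ x = b ∧ C₃ x = c := by grind
  have m₂ : ∀ x ∈ Q₂, x ∈ s ∧ C₁ x = a ∧ C₂ x = b' ∧ C₃ x = c' := by grind
  have m₃ : ∀ x ∈ Q₃, x ∈ s ∧ C₁ x = a' ∧ C₂ x = b ∧ C₃ x = c' := by grind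
  have m₄ : ∀ x ∈ Q₄, x ∈ s ∧ C₁ x = a' ∧ C₂ x = b' ∧ C₃ x = c := by grind
  have d₂ : Disjoint Q₁ Q₂ := Finset.disjoint_left.2 fun x h1 h2 => by
    have := m₁ x h1; have := m₂ x h2; grind
  have d₃ : Disjoint Q₁ Q₃ := Finset.disjoint_left.2 fun x h1 h2 => by
    have := m₁ x h1; have := m₃ x h2; grind
  have d₄ : Disjoint Q₁ Q₄ := Finset.disjoint_left.2 fun x h1 h2 => by
    have := m₁ x h1; have := m₄ x h2; grind
  have hcard : s.card ≤ Q₁.card + Q₂.card + Q₃.card + Q₄.card := by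
    classical
    have hs : s ⊆ ((Q₁ ∪ Q₂) ∪ Q₃) ∪ Q₄ := by
      intro x hx
      have := hQ x hx
      simp only [hQ₁, hQ₂, hQ₃, hQ₄, Finset.mem_union, Finset.mem_filter]
      tauto
    refine (Finset.card_le_card hs).trans ?_
    have := Finset.card_union_le ((Q₁ ∪ Q₂) ∪ Q₃) Q₄
    have := Finset.card_union_le (Q₁ ∪ Q₂) Q₃
    have := Finset.card_union_le Q₁ Q₂
    omega
  by_cases hne : Q₁.Nonempty
  swap
  · rw [Finset.not_nonempty_iff_eq_empty] at hne
    rw [hne, Finset.card_empty] at h₂ h₃ h₄ hcard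
    omega
  by_cases hw : ∃ w ∈ Q₁, H₁ w + H₂ w + H₃ w ≤ 1
  · obtain ⟨w, hw, hsum⟩ := hw
    obtain ⟨hws, w₁, w₂, w₃⟩ := m₁ w hw
    have hww := hpair w hws w hws
    obtain e | e | e : H₁ w = 1 ∨ H₂ w = 1 ∨ H₃ w = 1 := by omega
    · refine h.card_le_of_pointwise₁ a b c fun v hv => ?_
      have r1 := hpair v hv w hws
      have r2 := hQ v hv
      grind
    · refine h.card_le_of_pointwise₂ a b c fun v hv => ?_
      have r1 := hpair v hv w hws
      have r2 := hQ v hv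
      grind
    · refine h.card_le_of_pointwise₃ a b c fun v hv => ?_
      have r1 := hpair v hv w hws
      have r2 := hQ v hv
      grind
  push Not at hw
  obtain ⟨w₁, hw₁, hmin₁⟩ := Finset.exists_min_image Q₁ H₁ hne
  obtain ⟨w₂, hw₂, hmin₂⟩ := Finset.exists_min_image Q₁ H₂ hne
  obtain ⟨w₃, hw₃, hmin₃⟩ := Finset.exists_min_image Q₁ H₃ hne
  have u₁ := m₁ w₁ hw₁
  have u₂ := m₁ w₂ hw₂
  have u₃ := m₁ w₃ hw₃
  have e₁ := add_le_of_parts (P := Q₁) (Q := Q₂) (h.sum₁ a)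
    (Finset.filter_subset _ _) (Finset.filter_subset _ _) d₂
    (fun x hx => (m₁ x hx).2.1) (fun x hx => (m₂ x hx).2.1) (q := 2 - H₁ w₁) fun x hx => by
      have r1 := m₂ x hx
      have r2 := hpair x r1.1 w₁ u₁.1
      grind
  have e₂ := add_le_of_parts (P := Q₁) (Q := Q₃) (h.sum₂ b)
    (Finset.filter_subset _ _) (Finset.filter_subset _ _) d₃
    (fun x hx => (m₁ x hx).2.2.1) (fun x hx => (m₃ x hx).2.2.1) (q := 2 - H₂ w₂) fun x hx => by
      have r1 := m₃ x hx
      have r2 := hpair x r1.1 w₂ u₂.1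
      grind
  have e₃ := add_le_of_parts (P := Q₁) (Q := Q₄) (h.sum₃ c)
    (Finset.filter_subset _ _) (Finset.filter_subset _ _) d₄
    (fun x hx => (m₁ x hx).2.2.2) (fun x hx => (m₄ x hx).2.2.2) (q := 2 - H₃ w₃) fun x hx => by
      have r1 := m₄ x hx
      have r2 := hpair x r1.1 w₃ u₃.1
      grind
  have f₁ := Finset.card_nsmul_le_sum Q₁ (fun x => H₁ x) _ hmin₁
  have f₂ := Finset.card_nsmul_le_sum Q₁ (fun x => H₂ x) _ hmin₂
  have f₃ := Finset.card_nsmul_le_sum Q₁ (fun x => H₃ x) _ hmin₃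
  have f := Finset.card_nsmul_le_sum Q₁ (fun w => H₁ w + H₂ w + H₃ w) 2 fun x hx => hw x hx
  simp only [Finset.sum_add_distrib, smul_eq_mul] at f f₁ f₂ f₃
  have g₁ := h.le₁ w₁ u₁.1
  have g₂ := h.le₂ w₂ u₂.1
  have g₃ := h.le₃ w₃ u₃.1
  have l₁ := h.leM₁
  have l₂ := h.leM₂
  have l₃ := h.leM₃
  generalize H₁ w₁ = p₁ at *
  generalize H₂ w₂ = p₂ at *
  generalize H₃ w₃ = p₃ at *
  clear hmin₁ hmin₂ hmin₃ hpair hw hQ hle₁ hle₂ hle₃ m₁ m₂ m₃ m₄ d₂ d₃ d₄ u₁ u₂ u₃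
  clear_value Q₁ Q₂ Q₃ Q₄
  interval_cases p₁ <;> interval_cases p₂ <;> interval_cases p₃ <;> omega

theorem card_le_of_fano (h : CoverSystem s C₁ C₂ C₃ H₁ H₂ H₃ A₁ A₂ A₃ M) {a a' b b' c c' : β}
    (ha : a ≠ a') (hb : b ≠ b') (hc : c ≠ c')
    (hQ : ∀ x ∈ s, (C₁ x = a ∧ C₂ x = b ∧ C₃ x = c) ∨ (C₁ x = a ∧ C₂ x = b' ∧ C₃ x = c') ∨
      (C₁ x = a' ∧ C₂ x = b ∧ C₃ x = c') ∨ (C₁ x = a' ∧ C₂ x = b' ∧ C₃ x = c)) :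
    2 * s.card ≤ A₁ + A₂ + A₃ + M := by
  set n₁ := (s.filter fun x => C₁ x = a ∧ C₂ x = b).card with hn₁
  set n₂ := (s.filter fun x => C₁ x = a ∧ C₂ x = b').card with hn₂
  set n₃ := (s.filter fun x => C₁ x = a' ∧ C₂ x = b).card with hn₃
  set n₄ := (s.filter fun x => C₁ x = a' ∧ C₂ x = b').card with hn₄
  obtain o | o | o | o : (n₂ ≤ n₁ ∧ n₃ ≤ n₁ ∧ n₄ ≤ n₁) ∨ (n₁ ≤ n₂ ∧ n₃ ≤ n₂ ∧ n₄ ≤ n₂) ∨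
      (n₁ ≤ n₃ ∧ n₂ ≤ n₃ ∧ n₄ ≤ n₃) ∨ (n₁ ≤ n₄ ∧ n₂ ≤ n₄ ∧ n₃ ≤ n₄) := by omega
  · exact h.card_le_of_fano_aux ha hb hc hQ o.1 o.2.1 o.2.2
  · exact h.card_le_of_fano_aux ha hb.symm hc.symm (fun x hx => by have := hQ x hx; tauto)
      o.1 o.2.2 o.2.1
  · exact h.card_le_of_fano_aux ha.symm hb hc.symm (fun x hx => by have := hQ x hx; tauto)
      o.2.2 o.1 o.2.1
  · exact h.card_le_of_fano_aux ha.symm hb.symm hc (fun x hx => by have := hQ x hx; tauto)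
      o.2.2 o.2.1 o.1

/-- The case of two points that share only their first component, given a third point that shares
with the first of them only its second component. -/
theorem card_le_of_meet_once_aux (h : CoverSystem s C₁ C₂ C₃ H₁ H₂ H₃ A₁ A₂ A₃ M) {u v w : V}
    (hu : u ∈ s) (hv : v ∈ s) (hw : w ∈ s) (h₁ : C₁ u = C₁ v) (h₂ : C₂ u ≠ C₂ v)
    (h₃ : C₃ u ≠ C₃ v) (hw₁ : C₁ w ≠ C₁ u) (hw₂ : C₂ w = C₂ u) :
    2 * s.card ≤ A₁ + A₂ + A₃ + M := by
  have hw₃ : C₃ w = C₃ v := by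
    have := h.pair w hw v hv
    grind
  by_cases hz : ∃ z ∈ s, C₁ z = C₁ w ∧ C₂ z = C₂ v ∧ C₃ z = C₃ u
  · obtain ⟨z, hz, z₁, z₂, z₃⟩ := hz
    refine h.card_le_of_fano (a := C₁ u) (b := C₂ u) (c := C₃ u) hw₁.symm h₂ h₃ fun x hx => ?_
    have r1 := h.pair x hx u hu
    have r2 := h.pair x hx v hv
    have r3 := h.pair x hx w hw
    have r4 := h.pair x hx z hz
    grind
  · push Not at hz
    refine h.card_le_of_majority (a := C₁ u) (b := C₂ u) (c := C₃ v) fun x hx => ?_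
    have r1 := h.pair x hx u hu
    have r2 := h.pair x hx v hv
    have r3 := h.pair x hx w hw
    have r4 := hz x hx
    grind

theorem card_le_of_meet_once (h : CoverSystem s C₁ C₂ C₃ H₁ H₂ H₃ A₁ A₂ A₃ M) {u v : V}
    (hu : u ∈ s) (hv : v ∈ s) (h₁ : C₁ u = C₁ v) (h₂ : C₂ u ≠ C₂ v) (h₃ : C₃ u ≠ C₃ v) :
    2 * s.card ≤ A₁ + A₂ + A₃ + M := by
  by_cases hs : ∀ w ∈ s, C₁ w = C₁ u
  · exact h.card_le_of_spanning hs
  push Not at hs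
  obtain ⟨w, hw, hw₁⟩ := hs
  by_cases hw₂ : C₂ w = C₂ u
  · exact h.card_le_of_meet_once_aux hu hv hw h₁ h₂ h₃ hw₁ hw₂
  · have hw₃ : C₃ w = C₃ u := by
      have := h.pair w hw u hu
      grind
    have := h.swap₂₃.card_le_of_meet_once_aux hu hv hw h₁ h₃ h₂ hw₁ hw₃
    omega

theorem card_le (h : CoverSystem s C₁ C₂ C₃ H₁ H₂ H₃ A₁ A₂ A₃ M) :
    2 * s.card ≤ A₁ + A₂ + A₃ + M := by
  by_cases h1 : ∃ u ∈ s, ∃ v ∈ s, C₁ u = C₁ v ∧ C₂ u ≠ C₂ v ∧ C₃ u ≠ C₃ v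
  · obtain ⟨u, hu, v, hv, q1, q2, q3⟩ := h1
    exact h.card_le_of_meet_once hu hv q1 q2 q3
  by_cases h2 : ∃ u ∈ s, ∃ v ∈ s, C₂ u = C₂ v ∧ C₁ u ≠ C₁ v ∧ C₃ u ≠ C₃ v
  · obtain ⟨u, hu, v, hv, q1, q2, q3⟩ := h2
    have := h.swap₁₂.card_le_of_meet_once hu hv q1 q2 q3
    omega
  by_cases h3 : ∃ u ∈ s, ∃ v ∈ s, C₃ u = C₃ v ∧ C₁ u ≠ C₁ v ∧ C₂ u ≠ C₂ v
  · obtain ⟨u, hu, v, hv, q1, q2, q3⟩ := h3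
    have := h.swap₂₃.swap₁₂.card_le_of_meet_once hu hv q1 q2 q3
    omega
  push Not at h1 h2 h3
  obtain rfl | ⟨u, hu⟩ := s.eq_empty_or_nonempty
  · simp
  refine h.card_le_of_majority (a := C₁ u) (b := C₂ u) (c := C₃ u) fun x hx => ?_
  have r1 := h.pair x hx u hu
  have r2 := h1 x hx u hu
  have r3 := h2 x hx u hu
  have r4 := h3 x hx u hu
  grind

end CoverSystem

open Finset in
/-- A fractional form of the König–Hall theorem, via the bipartite double cover: a set of vertices
carries a partial injection along edges, and a half-integral vertex cover
whose (doubled) weight is at most the size of the domain of that injection. -/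
theorem SimpleGraph.exists_injOn_and_cover {V : Type*} [DecidableEq V] (R : SimpleGraph V)
    (F : Finset V) :
    ∃ (D : Finset V) (f : V → V) (H : V → ℕ), D ⊆ F ∧ Set.InjOn f D ∧ (∀ v ∈ D, R.Adj v (f v)) ∧
      (∀ v, H v ≤ 2) ∧ ∑ v ∈ F, H v ≤ #D ∧ ∀ u ∈ F, ∀ v ∈ F, R.Adj u v → 2 ≤ H u + H v := by
  classical
  let N : Finset V → Finset V := fun A => {v ∈ F | ∃ u ∈ A, R.Adj u v}
  have hN : ∀ A v, v ∈ N A ↔ v ∈ F ∧ ∃ u ∈ A, R.Adj u v := fun A v => by simp [N]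
  obtain ⟨A, hA, hmax⟩ := exists_max_image F.powerset (fun A => (#A : ℤ) - #(N A)) ⟨∅, by simp⟩
  rw [mem_powerset] at hA
  have hA₀ := hmax ∅ (by simp)
  have hN₀ : N ∅ = ∅ := by simp [N]
  rw [hN₀, card_empty] at hA₀
  obtain ⟨d, hd⟩ : ∃ d : ℕ, (d : ℤ) = #A - #(N A) := ⟨(#A - #(N A) : ℤ).toNat, by omega⟩
  let t : F → Finset (V ⊕ Fin d) := fun v => (N {v.1}).disjSum univ
  have hall : ∀ S : Finset F, #S ≤ #(S.biUnion t) := by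
    intro S
    obtain rfl | hS := S.eq_empty_or_nonempty
    · simp
    have h1 := hmax (S.image Subtype.val) (by
      rw [mem_powerset]
      intro v hv
      obtain ⟨w, -, rfl⟩ := mem_image.1 hv
      exact w.2)
    rw [card_image_of_injective _ Subtype.val_injective] at h1
    have h2 : (N (S.image Subtype.val)).disjSum (univ : Finset (Fin d)) ⊆ S.biUnion t := by
      intro x hx
      rw [mem_biUnion]
      rw [mem_disjSum] at hx
      obtain ⟨v, hv, rfl⟩ | ⟨j, -, rfl⟩ := hx
      · obtain ⟨hvF, u, hu, huv⟩ := (hN _ _).1 hv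
        obtain ⟨w, hw, rfl⟩ := mem_image.1 hu
        refine ⟨w, hw, ?_⟩
        simp only [t, inl_mem_disjSum, hN]
        exact ⟨hvF, _, mem_singleton_self _, huv⟩
      · obtain ⟨w, hw⟩ := hS
        exact ⟨w, hw, by simp [t]⟩
    have h3 := card_le_card h2
    rw [card_disjSum, card_univ, Fintype.card_fin] at h3
    omega
  obtain ⟨g, hg, hgt⟩ := (all_card_le_biUnion_card_iff_exists_injective t).1 hall
  let f : V → V := fun v => if h : v ∈ F then (g ⟨v, h⟩).elim id (fun _ => v) else v
  let D : Finset V := {v ∈ F | ∃ h : v ∈ F, (g ⟨v, h⟩).isLeft}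
  have hDF : D ⊆ F := filter_subset _ _
  have hfD : ∀ v ∈ D, ∃ h : v ∈ F, g ⟨v, h⟩ = Sum.inl (f v) := by
    intro v hv
    obtain ⟨-, h, hl⟩ := mem_filter.1 hv
    obtain ⟨y, hy⟩ := Sum.isLeft_iff.1 hl
    exact ⟨h, by simp [f, h, hy]⟩
  have hcard : #F ≤ #D + d := by
    have h1 : #(F \ D) ≤ #(univ : Finset (Fin d)) := by
      let k : V → V ⊕ Fin d := fun v => if h : v ∈ F then g ⟨v, h⟩ else Sum.inl v
      have h2 : #(F \ D) ≤ #((univ : Finset (Fin d)).map ⟨Sum.inr (α := V), Sum.inr_injective⟩) := by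
        refine card_le_card_of_injOn k ?_ ?_
        · intro v hv
          simp only [coe_sdiff, Set.mem_sdiff, mem_coe] at hv
          have h3 : ¬ (g ⟨v, hv.1⟩).isLeft := fun h => hv.2 (mem_filter.2 ⟨hv.1, hv.1, h⟩)
          rw [Sum.not_isLeft, Sum.isRight_iff] at h3
          obtain ⟨y, hy⟩ := h3
          simp [k, hv.1, hy]
        · intro v hv w hw hvw
          simp only [coe_sdiff, Set.mem_sdiff, mem_coe] at hv hw
          simp only [k, hv.1, hw.1, dif_pos] at hvw
          simpa using hg hvw
      simpa using h2
    rw [card_univ, Fintype.card_fin] at h1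
    have h2 := card_sdiff_add_card_eq_card hDF
    omega
  have hNF : N A ⊆ F := filter_subset _ _
  refine ⟨D, f, fun v => (if v ∈ A then 0 else 1) + (if v ∈ N A then 1 else 0), hDF, ?_, ?_, ?_,
    ?_, ?_⟩
  · intro v hv w hw hvw
    obtain ⟨hvF, h1⟩ := hfD v hv
    obtain ⟨hwF, h2⟩ := hfD w hw
    rw [hvw, ← h2] at h1
    simpa using hg h1
  · intro v hv
    obtain ⟨hvF, h1⟩ := hfD v hv
    have h2 := hgt ⟨v, hvF⟩
    rw [h1] at h2
    simp only [t, inl_mem_disjSum, hN, mem_singleton, exists_eq_left] at h2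
    exact h2.2
  · intro v
    dsimp only
    split_ifs <;> omega
  · rw [sum_add_distrib]
    have h1 : ∑ v ∈ F, (if v ∈ A then 0 else 1) + #A = #F := by
      have : ∑ v ∈ F, (if v ∈ A then 0 else 1) = #(F \ A) := by
        rw [card_eq_sum_ones, sdiff_eq_filter, sum_filter]
        exact sum_congr rfl fun x _ => by split_ifs <;> simp_all
      rw [this, card_sdiff_add_card_eq_card hA]
    have h2 : ∑ v ∈ F, (if v ∈ N A then 1 else 0) = #(N A) := by
      rw [sum_ite_mem, inter_eq_right.2 hNF, card_eq_sum_ones]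
    rw [h2]
    omega
  · intro u hu v hv huv
    have h1 : u ∈ A → v ∈ N A := fun h => (hN _ _).2 ⟨hv, u, h, huv⟩
    have h2 : v ∈ A → u ∈ N A := fun h => (hN _ _).2 ⟨hu, v, h, huv.symm⟩
    clear * - h1 h2
    clear_value N
    dsimp only
    split_ifs <;> simp_all

open Finset in
theorem Finset.exists_sum_eq_of_le_card_mul {V : Type*} (D : Finset V) (τ S : ℕ)
    (h : S ≤ #D * τ) : ∃ t : V → ℕ, (∀ v, t v ≤ τ) ∧ ∑ v ∈ D, t v = S := by
  classical
  induction D using Finset.induction generalizing S with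
  | empty => exact ⟨fun _ => 0, by simp, by simp at h ⊢; omega⟩
  | insert a D ha ih =>
    rw [card_insert_of_notMem ha, add_mul, one_mul] at h
    obtain ⟨t, ht, hs⟩ := ih (S - min S τ) (by omega)
    refine ⟨Function.update t a (min S τ), fun v => ?_, ?_⟩
    · rw [Function.update_apply]
      split_ifs
      · omega
      · exact ht v
    · have h1 : ∑ x ∈ D, Function.update t a (min S τ) x = ∑ x ∈ D, t x :=
        sum_congr rfl fun x hx => by
          rw [Function.update_of_ne]
          rintro rfl
          exact ha hx
      rw [sum_insert ha, Function.update_self, h1, hs]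
      omega

namespace SimpleGraph

variable {V : Type*} [DecidableEq V] {R : SimpleGraph V}

/-- Going back and forth along an edge. -/
theorem exists_zigzag_walk {u v : V} (h : R.Adj u v) (t : ℕ) :
    ∃ w : R.Walk u u, w.length = 2 * t ∧
      ∀ x, w.support.tail.count x ≤ (if u = x then t else 0) + (if v = x then t else 0) := by
  induction t with
  | zero => exact ⟨.nil, by simp, by simp⟩
  | succ t ih =>
    obtain ⟨w, hw, hx⟩ := ih
    refine ⟨.cons h (.cons h.symm w), by simp [hw]; ring, fun x => ?_⟩
    have := hx x
    have e : w.support = u :: w.support.tail := w.cons_tail_support.symm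
    simp only [Walk.support_cons, List.tail_cons]
    rw [e, List.count_cons, List.count_cons]
    simp only [beq_iff_eq]
    split_ifs at * <;> omega

open Finset in
theorem exists_closed_walk_aux [Fintype V] {s : V} (D : Finset V) (f : V → V)
    (hf : ∀ v ∈ D, R.Adj v (f v)) (hs : ∀ v ∈ D, R.Reachable s v) :
    ∃ l ≤ #D * Fintype.card V, ∀ t : V → ℕ, ∃ w : R.Walk s s,
      w.length = 2 * (l + ∑ v ∈ D, t v) ∧ ∀ x, w.support.tail.count x ≤
        2 * l + ∑ v ∈ D, ((if v = x then t v else 0) + (if f v = x then t v else 0)) := by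
  induction D using Finset.induction with
  | empty => exact ⟨0, by simp, fun t => ⟨.nil, by simp, by simp⟩⟩
  | insert a D ha ih =>
    obtain ⟨l, hl, hw⟩ := ih (fun v hv => hf v (mem_insert_of_mem hv))
      (fun v hv => hs v (mem_insert_of_mem hv))
    obtain ⟨p, hp⟩ := (hs a (mem_insert_self a D)).exists_isPath
    have hpl := hp.length_lt
    refine ⟨l + p.length, by rw [card_insert_of_notMem ha, add_mul]; omega, fun t => ?_⟩
    obtain ⟨w, hwl, hwc⟩ := hw t
    obtain ⟨z, hzl, hzc⟩ := exists_zigzag_walk (hf a (mem_insert_self a D)) (t a)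
    refine ⟨w.append (p.append (z.append p.reverse)), ?_, fun x => ?_⟩
    · simp only [Walk.length_append, Walk.length_reverse, sum_insert ha]
      omega
    · have h1 := hwc x
      have h2 := hzc x
      have h3 : p.support.tail.count x ≤ p.length :=
        List.count_le_length.trans (by simp)
      have h4 : p.reverse.support.tail.count x ≤ p.length :=
        List.count_le_length.trans (by simp)
      simp only [Walk.tail_support_append, List.count_append, sum_insert ha]
      omega

open Finset in
/-- In a component with a large partial injection along edges there are closed walks of every
suitable even length that visit no vertex too often. -/
theorem exists_closed_walk [Fintype V] {s : V} (D : Finset V) (f : V → V) (hinj : Set.InjOn f D)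
    (hf : ∀ v ∈ D, R.Adj v (f v)) (hs : ∀ v ∈ D, R.Reachable s v) {τ l : ℕ}
    (hl : #D * Fintype.card V ≤ l) (hτ : l ≤ #D * τ) :
    ∃ w : R.Walk s s, w.length = 2 * l ∧
      ∀ x, w.support.count x ≤ 1 + 2 * (#D * Fintype.card V) + 2 * τ := by
  obtain ⟨l₀, hl₀, h⟩ := exists_closed_walk_aux D f hf hs
  obtain ⟨t, ht, hsum⟩ := D.exists_sum_eq_of_le_card_mul τ (l - l₀) (by omega)
  obtain ⟨w, hw, hc⟩ := h t
  refine ⟨w, by omega, fun x => ?_⟩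
  have h1 := hc x
  have h2 : ∑ v ∈ D, (if v = x then t v else 0) ≤ τ := by
    rw [sum_ite_eq']
    split_ifs
    exacts [ht x, Nat.zero_le _]
  have h3 : ∑ v ∈ D, (if f v = x then t v else 0) ≤ τ := by
    by_cases hx : ∃ v ∈ D, f v = x
    · obtain ⟨v, hv, rfl⟩ := hx
      rw [sum_eq_single_of_mem v hv fun b hb hbv => if_neg fun h => hbv (hinj hb hv h)]
      simpa using ht v
    · push Not at hx
      rw [sum_eq_zero fun v hv => if_neg (hx v hv)]
      exact Nat.zero_le _
  rw [sum_add_distrib] at h1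
  have h4 : w.support = s :: w.support.tail := w.cons_tail_support.symm
  rw [h4, List.count_cons]
  split_ifs <;> omega

end SimpleGraph

namespace SimpleGraph

variable {V W : Type*} [DecidableEq V] [DecidableEq W]

open Finset in
open scoped Classical in
/-- `G` is `β`-dense along the reduced graph `R` with clusters `U`: for adjacent clusters, between
any two large subsets there is a vertex adjacent to at least a quarter of the other side. -/
def DenseAlong (G : SimpleGraph V) (R : SimpleGraph W) (U : W → Finset V) (β : ℕ) : Prop :=
  ∀ ⦃a b⦄, R.Adj a b → ∀ X ⊆ U a, ∀ Y ⊆ U b, β ≤ #X → β ≤ #Y →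
    ∃ x ∈ X, #Y ≤ 4 * #{y ∈ Y | G.Adj x y}

variable {G : SimpleGraph V} {R : SimpleGraph W} {U : W → Finset V} {β : ℕ}

open Finset in
/-- Embedding a walk of the reduced graph as a path. -/
theorem DenseAlong.exists_path (h : G.DenseAlong R U β)
    (hU : Pairwise (Function.onFun Disjoint U)) (hβ : 0 < β) {a b : W} (w : R.Walk a b)
    (hw : 0 < w.length) {S : W → Finset V} (hS : ∀ c, S c ⊆ U c)
    (hcard : ∀ c, w.support.count c + 4 * β ≤ #(S c)) {A B : Finset V} (hA : A ⊆ U a)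
    (hB : B ⊆ U b) (hAβ : β ≤ #A) (hBβ : β ≤ #B) (hAB : Disjoint A B)
    (hBS : ∀ c, Disjoint B (S c)) :
    ∃ y ∈ A, ∃ z ∈ B, ∃ p : G.Walk y z, p.IsPath ∧ p.length = w.length ∧
      ∀ x ∈ p.support, x ∈ A ∨ x ∈ B ∨ ∃ c, x ∈ S c := by
  classical
  induction w generalizing S A with
  | nil => simp at hw
  | @cons a a' b e w ih =>
    cases w with
    | nil =>
      obtain ⟨y, hy, hn⟩ := h e A hA B hB hAβ hBβ
      have : ({z ∈ B | G.Adj y z} : Finset V).Nonempty := by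
        rw [← card_pos]
        omega
      obtain ⟨z, hz⟩ := this
      rw [mem_filter] at hz
      refine ⟨y, hy, z, hz.1, .cons hz.2 .nil, ?_, by simp, ?_⟩
      · simpa using hz.2.ne
      · simp only [Walk.support_cons, Walk.support_nil, List.mem_cons, List.not_mem_nil, or_false]
        rintro x (rfl | rfl)
        exacts [Or.inl hy, Or.inr (Or.inl hz.1)]
    | cons e' w' =>
      generalize hww : Walk.cons e' w' = w at *
      have hpos : 0 < w.length := by rw [← hww]; simp
      have ha' := hcard a'
      obtain ⟨y, hy, hn⟩ := h e A hA (S a') (hS a') hAβ (by omega)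
      obtain ⟨y', hy', z, hz, p, hp, hpl, hps⟩ := ih hpos (S := fun c => (S c).erase y)
        (fun c => (erase_subset _ _).trans (hS c))
        (fun c => by
          have hc := hcard c
          rw [Walk.support_cons, List.count_cons] at hc
          by_cases hca : a = c
          · subst hca
            have := pred_card_le_card_erase (s := S a) (a := y)
            simp only [beq_self_eq_true, if_true] at hc
            omega
          · rw [erase_eq_of_notMem fun hyc =>
              Finset.disjoint_left.1 (hU hca) (hA hy) (hS c hyc)]
            omega)
        (A := {z ∈ S a' | G.Adj y z}) ((filter_subset _ _).trans (hS a')) hB (by omega)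
        ((hBS a').symm.mono_left (filter_subset _ _))
        (fun c => (hBS c).mono_right (erase_subset _ _))
      rw [mem_filter] at hy'
      refine ⟨y, hy, z, hz, .cons hy'.2 p, ?_, by simp [hpl], ?_⟩
      · rw [Walk.cons_isPath_iff]
        refine ⟨hp, fun hyp => ?_⟩
        obtain h1 | h1 | ⟨c, h1⟩ := hps y hyp
        · exact G.loopless.irrefl _ (mem_filter.1 h1).2
        · exact Finset.disjoint_left.1 hAB hy h1
        · exact notMem_erase _ _ h1
      · intro x hx
        rw [Walk.support_cons, List.mem_cons] at hx
        obtain rfl | hx := hx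
        · exact Or.inl hy
        · obtain h1 | h1 | ⟨c, h1⟩ := hps x hx
          · exact Or.inr (Or.inr ⟨a', (mem_filter.1 h1).1⟩)
          · exact Or.inr (Or.inl h1)
          · exact Or.inr (Or.inr ⟨c, (mem_erase.1 h1).2⟩)

open Finset in
/-- Embedding a closed walk of the reduced graph as a cycle. -/
theorem DenseAlong.exists_cycle (h : G.DenseAlong R U β)
    (hU : Pairwise (Function.onFun Disjoint U)) (hβ : 0 < β) {r s : W} (e : R.Adj r s)
    (w : R.Walk s s) (hw : 0 < w.length) (hcard : ∀ c, w.support.count c + 8 * β + 1 ≤ #(U c)) :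
    ∃ (x : V) (p : G.Walk x x), p.IsCycle ∧ p.length = w.length + 2 := by
  classical
  have hr := hcard r
  have hs := hcard s
  obtain ⟨x, hx, hn⟩ := h e (U r) subset_rfl (U s) subset_rfl (by omega) (by omega)
  obtain ⟨A, hA, hAc⟩ := exists_subset_card_eq (s := {y ∈ U s | G.Adj x y}) (n := β) (by omega)
  obtain ⟨B, hB, hBc⟩ := exists_subset_card_eq (s := {y ∈ U s | G.Adj x y} \ A) (n := β) (by
    rw [card_sdiff_of_subset hA]
    omega)
  have hAx : ∀ y ∈ A, G.Adj x y := fun y hy => (mem_filter.1 (hA hy)).2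
  have hBx : ∀ y ∈ B, G.Adj x y := fun y hy => (mem_filter.1 (mem_sdiff.1 (hB hy)).1).2
  have hAB : Disjoint A B :=
    Finset.disjoint_left.2 fun y hy hy' => (mem_sdiff.1 (hB hy')).2 hy
  obtain ⟨y, hy, z, hz, p, hp, hpl, hps⟩ := h.exists_path hU hβ w hw
    (S := fun c => (U c \ B).erase x) (fun c => (erase_subset _ _).trans sdiff_subset)
    (fun c => by
      have h1 := hcard c
      have h2 := pred_card_le_card_erase (s := U c \ B) (a := x)
      have h3 := le_card_sdiff B (U c)
      omega)
    (A := A) (B := B) (fun y hy => (mem_filter.1 (hA hy)).1)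
    (fun y hy => (mem_filter.1 (mem_sdiff.1 (hB hy)).1).1) hAc.ge hBc.ge hAB
    (fun c => Finset.disjoint_left.2 fun y hy hy' => (mem_sdiff.1 (mem_erase.1 hy').2).2 hy)
  have hxp : x ∉ p.support := by
    intro hx
    obtain h1 | h1 | ⟨c, h1⟩ := hps x hx
    · exact G.loopless.irrefl _ (hAx x h1)
    · exact G.loopless.irrefl _ (hBx x h1)
    · exact notMem_erase _ _ h1
  refine ⟨x, .cons (hAx y hy) (p.concat (hBx z hz).symm), ?_, by simp [hpl]⟩
  rw [Walk.cons_isCycle_iff]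
  refine ⟨hp.concat hxp _, ?_⟩
  rw [Walk.edges_concat, List.concat_eq_append, List.mem_append, List.mem_singleton]
  rintro (h1 | h1)
  · exact hxp (p.fst_mem_support_of_mem_edges h1)
  · rw [Sym2.eq_swap, Sym2.congr_left] at h1
    exact Finset.disjoint_left.1 hAB hy (h1 ▸ hz)

end SimpleGraph

open Finset in
/-- Merging classes of small weight: classes of weight at most `A` can be grouped into few bins
of weight at most `A`. -/
theorem exists_merge_classes {W : Type*} [Fintype W] [DecidableEq W] (C : W → W) (H : W → ℕ)
    {A r : ℕ} (hH : ∀ x, H x ≤ 2) (hA : ∀ c, ∑ x, (if C x = c then H x else 0) ≤ A)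
    (hr : 4 * Fintype.card W < r * A) :
    ∃ g : W → W, (∀ c, ∑ x, (if g (C x) = c then H x else 0) ≤ A) ∧
      #(univ.image fun x => g (C x)) ≤ r := by
  obtain ⟨g, hg, hmin⟩ := exists_min_image
    (univ.filter fun g : W → W => ∀ c, ∑ x, (if g (C x) = c then H x else 0) ≤ A)
    (fun g => #(univ.image fun x => g (C x))) ⟨id, by simpa using hA⟩
  rw [mem_filter] at hg
  refine ⟨g, hg.2, ?_⟩
  set w : W → ℕ := fun c => ∑ x, (if g (C x) = c then H x else 0) with hw
  set I := univ.image fun x => g (C x) with hI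
  have hpair : ∀ c ∈ I, ∀ d ∈ I, c ≠ d → A < w c + w d := by
    intro c hc d hd hcd
    by_contra! hle
    let g' : W → W := fun x => if g x = d then c else g x
    have h1 := hmin g' (mem_filter.2 ⟨mem_univ _, fun e => ?_⟩)
    · have h2 : (univ.image fun x => g' (C x)) ⊆ I.erase d := by
        intro y hy
        obtain ⟨x, -, rfl⟩ := mem_image.1 hy
        simp only [g']
        split_ifs with h
        · exact mem_erase.2 ⟨hcd, hc⟩
        · exact mem_erase.2 ⟨h, mem_image_of_mem _ (mem_univ _)⟩
      have h3 := card_le_card h2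
      rw [card_erase_of_mem hd] at h3
      have := card_pos.2 ⟨d, hd⟩
      omega
    · by_cases hec : e = c
      · refine le_trans (le_of_eq ?_) hle
        rw [hw, ← sum_add_distrib]
        refine sum_congr rfl fun x _ => ?_
        simp only [g']
        grind
      · refine le_trans (sum_le_sum fun x _ => ?_) (hg.2 e)
        simp only [g']
        grind
  have htot : ∑ c ∈ I, w c ≤ 2 * Fintype.card W := by
    rw [hw, sum_comm]
    have : ∀ x ∈ (univ : Finset W), ∑ c ∈ I, (if g (C x) = c then H x else 0) ≤ 2 := by
      intro x _
      rw [sum_ite_eq]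
      split_ifs
      exacts [hH x, Nat.zero_le _]
    refine (sum_le_card_nsmul _ _ _ this).trans ?_
    simp [mul_comm]
  obtain hI0 | hI0 := I.eq_empty_or_nonempty
  · simp [hI0]
  obtain ⟨c, hc, hcmin⟩ := exists_min_image I w hI0
  have h1 : ∀ d ∈ I.erase c, A + 1 ≤ 2 * w d := by
    intro d hd
    rw [mem_erase] at hd
    have := hpair d hd.2 c hc hd.1
    have := hcmin d hd.2
    omega
  have h2 := card_nsmul_le_sum _ _ _ h1
  rw [← mul_sum, smul_eq_mul, card_erase_of_mem hc] at h2
  have h3 : ∑ d ∈ I.erase c, w d ≤ ∑ d ∈ I, w d := sum_le_sum_of_subset (erase_subset _ _)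
  by_contra! hlt
  have h4 : r * A ≤ (#I - 1) * (A + 1) := Nat.mul_le_mul (by omega) (by omega)
  omega

open Finset in
/-- The weight bound for a family of classes and weights in which only few pairs of points are
not covered in any color. -/
theorem two_mul_card_le_of_few_uncovered {W : Type*} [Fintype W] [DecidableEq W]
    (C : Fin 3 → W → W) (H : Fin 3 → W → ℕ) (A : Fin 3 → ℕ) {M r m : ℕ}
    (hH : ∀ i x, H i x ≤ 2) (hA : ∀ i c, ∑ x, (if C i x = c then H i x else 0) ≤ A i)
    (hM : ∀ i, A i ≤ M) (hr : ∀ i, 4 * Fintype.card W < r * A i)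
    (hbad : #{p : W × W | ∀ i, ¬ (C i p.1 = C i p.2 ∧ 2 ≤ H i p.1 + H i p.2)} < m ^ 2) :
    2 * Fintype.card W ≤ A 0 + A 1 + A 2 + M + 2 * (27 * r ^ 3 * m) := by
  choose g hg hgr using fun i => exists_merge_classes (C i) (H i) (hH i) (hA i) (hr i)
  let I : Fin 3 → Finset W := fun i => univ.image fun x => g i (C i x)
  let φ : W → (Fin 3 → W × ℕ) := fun x i => (g i (C i x), H i x)
  let T : Finset (Fin 3 → W × ℕ) := Fintype.piFinset fun i => I i ×ˢ range 3
  have hφ : ∀ x, φ x ∈ T := fun x => by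
    rw [Fintype.mem_piFinset]
    intro i
    rw [mem_product, mem_range]
    exact ⟨mem_image_of_mem _ (mem_univ _), Nat.lt_succ_of_le (hH i x)⟩
  have hT : #T ≤ 27 * r ^ 3 := by
    rw [Fintype.card_piFinset]
    refine (prod_le_pow_card _ _ (r * 3) fun i _ => ?_).trans (le_of_eq ?_)
    · rw [card_product, card_range]
      exact Nat.mul_le_mul_right _ (hgr i)
    · rw [card_univ, Fintype.card_fin]
      ring
  let s : Finset W := {x | m ≤ #{y | φ y = φ x}}
  have hs : Fintype.card W ≤ #s + 27 * r ^ 3 * m := by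
    have h1 : #(univ \ s) ≤ m * #T := by
      refine card_le_mul_card_image_of_maps_to (f := φ) (fun x _ => hφ x) m fun t _ => ?_
      by_cases hx : ∃ x ∈ univ \ s, φ x = t
      · obtain ⟨x, hx, rfl⟩ := hx
        have h2 : #{y | φ y = φ x} < m := by simpa [s] using hx
        exact (card_le_card (filter_subset_filter _ (subset_univ _))).trans h2.le
      · push Not at hx
        rw [filter_eq_empty_iff.2 fun x hxs => hx x hxs]
        simp
    have h2 := card_sdiff_add_card_eq_card (subset_univ s)
    have h3 : m * #T ≤ 27 * r ^ 3 * m := by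
      rw [mul_comm]
      exact Nat.mul_le_mul_right _ hT
    rw [card_univ] at h2
    omega
  have hsys : CoverSystem s (fun x => g 0 (C 0 x)) (fun x => g 1 (C 1 x)) (fun x => g 2 (C 2 x))
      (H 0) (H 1) (H 2) (A 0) (A 1) (A 2) M := by
    have hsum : ∀ i c, ∑ x ∈ s, (if g i (C i x) = c then H i x else 0) ≤ A i := fun i c =>
      (sum_le_sum_of_subset (subset_univ s)).trans (hg i c)
    refine ⟨fun x hx y hy => ?_, fun x _ => hH 0 x, fun x _ => hH 1 x, fun x _ => hH 2 x,
      hsum 0, hsum 1, hsum 2, hM 0, hM 1, hM 2⟩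
    have hx' : m ≤ #{z | φ z = φ x} := (mem_filter.1 hx).2
    have hy' : m ≤ #{z | φ z = φ y} := (mem_filter.1 hy).2
    have h1 : m ^ 2 ≤ #(({z | φ z = φ x} : Finset W) ×ˢ ({z | φ z = φ y} : Finset W)) := by
      rw [card_product, sq]
      exact Nat.mul_le_mul hx' hy'
    obtain ⟨⟨x', y'⟩, hp, hnp⟩ := exists_mem_notMem_of_card_lt_card (hbad.trans_le h1)
    rw [mem_product, mem_filter, mem_filter] at hp
    simp only [mem_filter, mem_univ, true_and, not_forall, not_not] at hnp
    obtain ⟨i, hi⟩ := hnp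
    have e1 := congrFun hp.1.2 i
    have e2 := congrFun hp.2.2 i
    simp only [φ, Prod.mk.injEq] at e1 e2
    have key : g i (C i x) = g i (C i y) ∧ 2 ≤ H i x + H i y := by
      rw [← e1.1, ← e2.1, ← e1.2, ← e2.2, hi.1]
      exact ⟨rfl, hi.2⟩
    fin_cases i
    exacts [Or.inl key, Or.inr (Or.inl key), Or.inr (Or.inr key)]
  have := hsys.card_le
  omega

open Finset in
theorem SimpleGraph.IsUniform.exists_card_le {V : Type*} [DecidableEq V] {G : SimpleGraph V}
    [DecidableRel G.Adj] {ε : ℝ} (hε : ε ≤ 1 / 12) {S T X Y : Finset V} (hu : G.IsUniform ε S T)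
    (hd : (1 / 3 : ℝ) ≤ G.edgeDensity S T) (hX : X ⊆ S) (hY : Y ⊆ T) (hXε : #S * ε ≤ #X)
    (hYε : #T * ε ≤ #Y) (hX0 : 0 < #X) :
    ∃ x ∈ X, #Y ≤ 4 * #{y ∈ Y | G.Adj x y} := by
  by_contra! hlt
  have h1 := hu hX hY hXε hYε
  have h2 : (1 / 4 : ℝ) < G.edgeDensity X Y := by
    rw [abs_lt] at h1
    linarith [h1.1]
  have h3 : #(G.interedges X Y) = ∑ x ∈ X, #{y ∈ Y | G.Adj x y} := by
    rw [SimpleGraph.interedges, Rel.interedges, card_filter, sum_product]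
    simp only [card_filter]
  have h4 : 4 * #(G.interedges X Y) ≤ #X * #Y := by
    rw [h3, mul_sum]
    refine (sum_le_card_nsmul _ _ _ fun x hx => (hlt x hx).le).trans (by simp)
  obtain hY0 | hY0 := Nat.eq_zero_or_pos #Y
  · obtain ⟨x, hx⟩ := card_pos.1 hX0
    have := hlt x hx
    omega
  have h5 : (G.edgeDensity X Y : ℝ) = #(G.interedges X Y) / (#X * #Y) := by
    rw [SimpleGraph.edgeDensity_def]
    push_cast
    rfl
  rw [h5, lt_div_iff₀ (by positivity)] at h2
  have h6 : (4 * #(G.interedges X Y) : ℝ) ≤ #X * #Y := by exact_mod_cast h4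
  linarith

open Finset in
theorem SimpleGraph.exists_third_le_edgeDensity {V : Type*} [DecidableEq V]
    (G : Fin 3 → SimpleGraph V) [∀ i, DecidableRel (G i).Adj]
    (hG : ∀ u v, u ≠ v → ∃ i, (G i).Adj u v) {S T : Finset V} (hS : S.Nonempty) (hT : T.Nonempty)
    (hd : Disjoint S T) : ∃ i, (1 / 3 : ℝ) ≤ (G i).edgeDensity S T := by
  by_contra! hlt
  have h1 : S ×ˢ T ⊆ univ.biUnion fun i => (G i).interedges S T := by
    rintro ⟨x, y⟩ hxy
    rw [mem_product] at hxy
    obtain ⟨i, hi⟩ := hG x y fun h => Finset.disjoint_left.1 hd hxy.1 (h ▸ hxy.2)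
    exact mem_biUnion.2 ⟨i, mem_univ _, (SimpleGraph.mem_interedges_iff (G i)).2 ⟨hxy.1, hxy.2, hi⟩⟩
  have h2 := (card_le_card h1).trans card_biUnion_le
  rw [card_product] at h2
  have h3 : ∀ i, ((G i).edgeDensity S T : ℝ) = #((G i).interedges S T) / (#S * #T) := by
    intro i
    rw [SimpleGraph.edgeDensity_def]
    push_cast
    rfl
  have hpos : (0 : ℝ) < #S * #T := by
    have := card_pos.2 hS
    have := card_pos.2 hT
    positivity
  have h4 : ∀ i ∈ (univ : Finset (Fin 3)), (#((G i).interedges S T) : ℝ) < 1 / 3 * (#S * #T) := by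
    intro i _
    have := hlt i
    rwa [h3, div_lt_iff₀ hpos] at this
  have h5 := sum_lt_sum_of_nonempty univ_nonempty h4
  rw [sum_const, card_univ, Fintype.card_fin] at h5
  have h6 : (#S * #T : ℝ) ≤ ∑ i, (#((G i).interedges S T) : ℝ) := by exact_mod_cast h2
  have h7 : (3 • (1 / 3 * (#S * #T)) : ℝ) = #S * #T := by
    rw [nsmul_eq_mul]
    push_cast
    ring
  linarith

open Finset in
/-- Either there is a cycle of prescribed even length, or the reduced graph has a half-integral
vertex cover whose weight on each component is small. -/
theorem SimpleGraph.DenseAlong.exists_cycle_or_cover {V W : Type*} [DecidableEq V] [Fintype W]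
    [DecidableEq W] {G : SimpleGraph V} {R : SimpleGraph W} {U : W → Finset V} {β A τ l : ℕ}
    (h : G.DenseAlong R U β) (hU : Pairwise (Function.onFun Disjoint U)) (hβ : 0 < β)
    (hl : Fintype.card W ^ 2 ≤ l) (hl₀ : 0 < l) (hlτ : l ≤ A * τ)
    (hcard : ∀ c, 2 * Fintype.card W ^ 2 + 2 * τ + 8 * β + 2 ≤ #(U c)) :
    (∃ (x : V) (p : G.Walk x x), p.IsCycle ∧ p.length = 2 * (l + 1)) ∨
      ∃ (C : W → W) (H : W → ℕ), (∀ x, H x ≤ 2) ∧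
        (∀ c, ∑ x, (if C x = c then H x else 0) ≤ A) ∧
        ∀ a b, R.Adj a b → C a = C b ∧ 2 ≤ H a + H b := by
  classical
  choose D f H hDF hinj hadj hH2 hsum hcov using fun F : R.ConnectedComponent =>
    R.exists_injOn_and_cover {x | R.connectedComponentMk x = F}
  by_cases hbig : ∃ F, A < #(D F)
  · left
    obtain ⟨F, hF⟩ := hbig
    obtain ⟨s, hs⟩ : (D F).Nonempty := by
      rw [← card_pos]
      omega
    have hmk : ∀ v ∈ D F, R.connectedComponentMk v = F := fun v hv => by
      simpa using hDF F hv
    have hDk : #(D F) * Fintype.card W ≤ Fintype.card W ^ 2 := by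
      rw [sq]
      exact Nat.mul_le_mul_right _ (card_le_univ _)
    obtain ⟨w, hw, hwc⟩ := R.exists_closed_walk (s := s) (D F) (f F) (hinj F) (hadj F)
      (fun v hv => ConnectedComponent.exact ((hmk s hs).trans (hmk v hv).symm)) (τ := τ) (l := l)
      (hDk.trans hl) (hlτ.trans (Nat.mul_le_mul_right _ hF.le))
    obtain ⟨x, p, hp, hpl⟩ := h.exists_cycle hU hβ (hadj F s hs).symm w (by omega) fun c => by
      have h1 := hwc c
      have h2 := hcard c
      omega
    exact ⟨x, p, hp, by omega⟩
  · right
    push Not at hbig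
    choose rep hrep using fun F : R.ConnectedComponent => F.exists_rep
    have hinj' : Function.Injective rep := fun F F' h => by rw [← hrep F, ← hrep F', h]
    refine ⟨fun x => rep (R.connectedComponentMk x), fun x => H (R.connectedComponentMk x) x,
      fun x => hH2 _ _, fun c => ?_, fun a b hab => ?_⟩
    · by_cases hc : ∃ F, rep F = c
      · obtain ⟨F, rfl⟩ := hc
        refine le_trans (le_of_eq ?_) ((hsum F).trans (hbig F))
        rw [sum_filter]
        refine sum_congr rfl fun x _ => ?_
        simp only [hinj'.eq_iff]
        split_ifs with hx
        · rw [hx]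
        · rfl
      · push Not at hc
        simp [hc]
    · have h1 : R.connectedComponentMk a = R.connectedComponentMk b :=
        ConnectedComponent.sound hab.reachable
      dsimp only
      rw [h1]
      exact ⟨rfl, hcov _ a (mem_filter.2 ⟨mem_univ _, h1⟩) b (mem_filter.2 ⟨mem_univ _, rfl⟩) hab⟩

open Finset in
/-- The combinatorial core of the upper bound: a 3-edge-colored complete graph with a regular
partition contains one of the required monochromatic even cycles. -/
theorem Finpartition.exists_mono_cycle {V : Type*} [Fintype V] [DecidableEq V]
    (G : Fin 3 → SimpleGraph V) [∀ i, DecidableRel (G i).Adj]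
    (hG : ∀ u v, u ≠ v → ∃ i, (G i).Adj u v) {ε : ℝ} (hε₀ : 0 ≤ ε) (hε : ε ≤ 1 / 12)
    (P : Finpartition (univ : Finset V)) (hP : ∀ i, P.IsUniform (G i) ε) {A τ l : Fin 3 → ℕ}
    {β r m M : ℕ} (hβ : 0 < β) (hβε : ∀ S ∈ P.parts, #S * ε ≤ β)
    (hl : ∀ i, #P.parts ^ 2 ≤ l i) (hl₀ : ∀ i, 0 < l i) (hlτ : ∀ i, l i ≤ A i * τ i)
    (hcard : ∀ S ∈ P.parts, ∀ i, 2 * #P.parts ^ 2 + 2 * τ i + 8 * β + 2 ≤ #S)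
    (hM : ∀ i, A i ≤ M) (hr : ∀ i, 4 * #P.parts < r * A i)
    (hm : 3 * (#P.parts ^ 2 * ε) + #P.parts < m ^ 2)
    (hlt : A 0 + A 1 + A 2 + M + 2 * (27 * r ^ 3 * m) < 2 * #P.parts) :
    ∃ (i : Fin 3) (x : V) (p : (G i).Walk x x), p.IsCycle ∧ p.length = 2 * (l i + 1) := by
  by_contra! hno
  let U : P.parts → Finset V := Subtype.val
  have hUd : Pairwise (Function.onFun Disjoint U) := fun a b hab =>
    P.disjoint a.2 b.2 fun h => hab (Subtype.ext h)
  let R : Fin 3 → SimpleGraph P.parts := fun i =>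
    { Adj := fun a b => a ≠ b ∧ (G i).IsUniform ε (U a) (U b) ∧
        (1 / 3 : ℝ) ≤ (G i).edgeDensity (U a) (U b)
      symm := ⟨fun a b h => ⟨h.1.symm, h.2.1.symm, by rw [SimpleGraph.edgeDensity_comm]; exact h.2.2⟩⟩
      loopless := ⟨fun a h => h.1 rfl⟩ }
  have hR : ∀ i, (G i).DenseAlong (R i) U β := by
    intro i a b hab X hX Y hY hXβ hYβ
    have h1 : (β : ℝ) ≤ #X := by exact_mod_cast hXβ
    have h2 : (β : ℝ) ≤ #Y := by exact_mod_cast hYβ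
    obtain ⟨x, hx, hn⟩ := hab.2.1.exists_card_le hε hab.2.2 hX hY
      ((hβε _ a.2).trans h1) ((hβε _ b.2).trans h2) (hβ.trans_le hXβ)
    refine ⟨x, hx, ?_⟩
    convert hn
  have hk : Fintype.card P.parts = #P.parts := Fintype.card_coe _
  have hcov : ∀ i, ∃ (C : P.parts → P.parts) (H : P.parts → ℕ), (∀ x, H x ≤ 2) ∧
      (∀ c, ∑ x, (if C x = c then H x else 0) ≤ A i) ∧
      ∀ a b, (R i).Adj a b → C a = C b ∧ 2 ≤ H a + H b := by
    intro i
    obtain ⟨x, p, hp, hpl⟩ | h := (hR i).exists_cycle_or_cover hUd hβ (A := A i) (τ := τ i)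
      (l := l i) (by rw [hk]; exact hl i) (hl₀ i) (hlτ i)
      (fun c => by rw [hk]; exact hcard _ c.2 i)
    · exact absurd hpl (hno i x p hp)
    · exact h
  choose C H hH hsum hadj using hcov
  refine absurd (two_mul_card_le_of_few_uncovered C H A (m := m) hH hsum hM
    (by rw [hk]; exact hr) ?_) (by rw [hk]; omega)
  have hsub : (univ.filter fun p : P.parts × P.parts =>
      ∀ i, ¬ (C i p.1 = C i p.2 ∧ 2 ≤ H i p.1 + H i p.2)).map
        (Function.Embedding.prodMap (.subtype _) (.subtype _)) ⊆
      P.parts.diag ∪ univ.biUnion fun i => P.nonUniforms (G i) ε := by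
    intro q hq
    obtain ⟨⟨a, b⟩, hab, rfl⟩ := mem_map.1 hq
    have hab := (mem_filter.1 hab).2
    rw [mem_union, mem_biUnion]
    by_contra! hcon
    have hne : a ≠ b := by
      rintro rfl
      exact hcon.1 (mem_diag.2 ⟨a.2, rfl⟩)
    have hun : ∀ i, (G i).IsUniform ε (U a) (U b) := by
      intro i
      by_contra hi
      exact hcon.2 i (mem_univ _) ((P.mk_mem_nonUniforms (G i)).2
        ⟨a.2, b.2, fun h => hne (Subtype.ext h), hi⟩)
    obtain ⟨i, hi⟩ := SimpleGraph.exists_third_le_edgeDensity G hG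
      (P.nonempty_of_mem_parts a.2) (P.nonempty_of_mem_parts b.2) (hUd hne)
    exact hab i (hadj i a b ⟨hne, hun i, hi⟩)
  have h1 := (card_le_card hsub).trans (card_union_le _ _)
  rw [card_map, diag_card] at h1
  have h2 := h1.trans (Nat.add_le_add_left card_biUnion_le _)
  have h3 : ∀ i ∈ (univ : Finset (Fin 3)), (#(P.nonUniforms (G i) ε) : ℝ) ≤ #P.parts ^ 2 * ε := by
    intro i _
    refine (hP i).trans ?_
    refine mul_le_mul_of_nonneg_right ?_ hε₀
    rw [sq]
    exact_mod_cast Nat.mul_le_mul_left _ (Nat.sub_le _ _)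
  have h4 := sum_le_sum h3
  rw [sum_const, card_univ, Fintype.card_fin, nsmul_eq_mul] at h4
  have h5 : (#(univ.filter fun p : P.parts × P.parts =>
      ∀ i, ¬ (C i p.1 = C i p.2 ∧ 2 ≤ H i p.1 + H i p.2)) : ℝ) ≤
      #P.parts + ∑ i, (#(P.nonUniforms (G i) ε) : ℝ) := by exact_mod_cast h2
  have h6 : (#(univ.filter fun p : P.parts × P.parts =>
      ∀ i, ¬ (C i p.1 = C i p.2 ∧ 2 ≤ H i p.1 + H i p.2)) : ℝ) < m ^ 2 := by
    push_cast at h4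
    linarith
  exact_mod_cast h6

theorem exists_cluster_parameters {N k : ℕ} {ε x : ℝ} (hk : 0 < k) (hε₀ : 0 < ε)
    (hε : ε ≤ 1 / 36) (hN : x - 1 ≤ N) (hx : 1 + k * (13 + 2 * k ^ 2) ≤ x * ε) :
    ∃ β τ : ℕ, 0 < β ∧ ((N / k : ℕ) + 1) * ε ≤ β ∧ 2 * k ^ 2 + 2 * τ + 8 * β + 2 ≤ N / k ∧
      x * (1 - 9 * ε) ≤ k * (2 * τ) := by
  have hk' : (0 : ℝ) < k := by exact_mod_cast hk
  set σ := N / k with hσ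
  have h1 : (N : ℝ) ≤ k * (σ + 1) := by
    have := (Nat.lt_div_mul_add (a := N) hk).le
    rw [← hσ] at this
    have h : (N : ℝ) ≤ σ * k + k := by exact_mod_cast this
    linarith
  have h2 : k * (σ : ℝ) ≤ N := by exact_mod_cast Nat.mul_div_le N k
  set β := ⌈((σ : ℝ) + 1) * ε⌉₊ with hβ
  have hβ1 : ((σ : ℝ) + 1) * ε ≤ β := Nat.le_ceil _
  have hβ2 : (β : ℝ) < (σ + 1) * ε + 1 := Nat.ceil_lt_add_one (by positivity)
  have hβ0 : 0 < β := Nat.ceil_pos.2 (by positivity)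
  have key : (k : ℝ) * (2 * k ^ 2 + 8 * β + 3) + x * (1 - 9 * ε) ≤ k * σ := by
    have e1 : (k : ℝ) * β ≤ k * ((σ + 1) * ε + 1) := mul_le_mul_of_nonneg_left hβ2.le hk'.le
    have e2 : (x - 1) * (1 - 8 * ε) ≤ k * (σ + 1) * (1 - 8 * ε) :=
      mul_le_mul_of_nonneg_right (hN.trans h1) (by linarith)
    have e3 : (k : ℝ) * ε ≤ k * (1 / 36) := mul_le_mul_of_nonneg_left hε hk'.le
    nlinarith
  have hx0 : 0 ≤ x * (1 - 9 * ε) := by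
    have : 0 < x * ε := by
      refine lt_of_lt_of_le ?_ hx
      positivity
    have : 0 < x := (pos_iff_pos_of_mul_pos this).2 hε₀
    exact mul_nonneg this.le (by linarith)
  have hle : 2 * k ^ 2 + 8 * β + 3 ≤ σ := by
    have h : (k : ℝ) * (2 * k ^ 2 + 8 * β + 3) ≤ k * σ := by linarith
    have := le_of_mul_le_mul_left h hk'
    exact_mod_cast this
  refine ⟨β, (σ - (2 * k ^ 2 + 8 * β + 2)) / 2, hβ0, hβ1, by omega, ?_⟩
  have h3 : σ ≤ 2 * ((σ - (2 * k ^ 2 + 8 * β + 2)) / 2) + (2 * k ^ 2 + 8 * β + 3) := by omega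
  generalize (σ - (2 * k ^ 2 + 8 * β + 2)) / 2 = τ at *
  have h4 : (σ : ℝ) ≤ 2 * τ + (2 * k ^ 2 + 8 * β + 3) := by exact_mod_cast h3
  have h5 := mul_le_mul_of_nonneg_left h4 hk'.le
  linarith

set_option maxHeartbeats 1000000 in
open Finset in
/-- Every 3-coloring of a complete graph on about `(2 α₀ + α₁ + α₂ + δ) n` vertices contains, in
some color `i`, a cycle on `2 ⌊αᵢ n⌋` vertices. -/
theorem exists_mono_cycle_of_three_coloring (α : Fin 3 → ℝ) (hα : ∀ i, 0 < α i)
    (hα₀ : ∀ i, α i ≤ α 0) {δ : ℝ} (hδ : 0 < δ) :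
    ∃ n₀ : ℕ, ∀ n : ℕ, n₀ ≤ n → ∀ (V : Type) [Fintype V] (G : Fin 3 → SimpleGraph V),
      Fintype.card V = ⌊(2 * α 0 + α 1 + α 2 + δ) * n⌋₊ →
      (∀ u v, u ≠ v → ∃ i, (G i).Adj u v) →
      ∃ (i : Fin 3) (x : V) (p : (G i).Walk x x), p.IsCycle ∧ p.length = 2 * ⌊α i * n⌋₊ := by
  classical
  have h0 := hα 0
  have h1 := hα 1
  have h2 := hα 2
  set K := 2 * α 0 + α 1 + α 2 + δ with hK
  have hK0 : 0 < K := by linarith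
  set η := δ / (4 * K) with hη
  have hη0 : 0 < η := by positivity
  have hηK : K * η = δ / 4 := by rw [hη]; field_simp
  set r := ⌊8 / η⌋₊ + 1 with hr
  have hrη : 8 / η < r := by rw [hr]; push_cast; exact Nat.lt_floor_add_one _
  have hr0 : (0 : ℝ) < r := lt_trans (by positivity) hrη
  set μ := δ / (K * (108 * r ^ 3)) with hμ
  have hμ0 : 0 < μ := by positivity
  set ε := min (1 / 36) (min (μ ^ 2 / 24) (δ / (9 * (16 * α 0 + δ)))) with hε
  have hε0 : 0 < ε := by
    rw [hε]
    exact lt_min (by norm_num) (lt_min (by positivity) (by positivity))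
  have hε1 : ε ≤ 1 / 36 := min_le_left _ _
  have hε2 : ε ≤ μ ^ 2 / 24 := (min_le_right _ _).trans (min_le_left _ _)
  have hε3 : ε ≤ δ / (9 * (16 * α 0 + δ)) := (min_le_right _ _).trans (min_le_right _ _)
  obtain ⟨M, hM⟩ := exists_bound_regularity_three hε0 (hε1.trans (by norm_num))
    (max ⌈2 / η⌉₊ (max ⌈2 / μ⌉₊ (⌈8 / μ ^ 2⌉₊ + 1)))
  have hev : ∀ c d : ℝ, 0 < d → ∃ n₀ : ℕ, ∀ n : ℕ, n₀ ≤ n → c ≤ d * n := by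
    intro c d hd
    obtain ⟨n₀, hn₀⟩ := exists_nat_ge (c / d)
    refine ⟨n₀, fun n hn => ?_⟩
    have : c / d ≤ n := hn₀.trans (by exact_mod_cast hn)
    rwa [div_le_iff₀' hd] at this
  obtain ⟨n₁, hn₁⟩ := hev (M + 1) K hK0
  obtain ⟨n₂, hn₂⟩ := hev (1 + M * (13 + 2 * M ^ 2)) (K * ε) (by positivity)
  choose n₃ hn₃ using fun i => hev (M ^ 2 + 3) (α i) (hα i)
  refine ⟨max (max n₁ n₂) (max (n₃ 0) (max (n₃ 1) (n₃ 2))), fun n hn V _ G hV hG => ?_⟩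
  simp only [max_le_iff] at hn
  obtain ⟨⟨g₁, g₂⟩, g₃, g₄, g₅⟩ := hn
  have c₁ := hn₁ n g₁
  have c₂ := hn₂ n g₂
  have c₃ : ∀ i, (M : ℝ) ^ 2 + 3 ≤ α i * n := by
    intro i
    fin_cases i
    exacts [hn₃ 0 n g₃, hn₃ 1 n g₄, hn₃ 2 n g₅]
  have hVN : K * n - 1 ≤ Fintype.card V := by
    rw [hV]
    linarith [Nat.lt_floor_add_one (K * n)]
  have hMV : M ≤ Fintype.card V := by
    have : (M : ℝ) ≤ Fintype.card V := by linarith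
    exact_mod_cast this
  obtain ⟨P, hPe, hPl, hPM, hPu⟩ := hM V G hMV
  set k := #P.parts with hk
  simp only [max_le_iff] at hPl
  obtain ⟨k₁, k₂, k₃⟩ := hPl
  have k₁' : 2 / η ≤ k := Nat.ceil_le.1 k₁
  have k₂' : 2 / μ ≤ k := Nat.ceil_le.1 k₂
  have k₃' : 8 / μ ^ 2 < k := (Nat.le_ceil _).trans_lt (by exact_mod_cast k₃)
  have hkpos : 0 < k := by omega
  have hk0 : (0 : ℝ) < k := by exact_mod_cast hkpos
  have hkM : (k : ℝ) ≤ M := by exact_mod_cast hPM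
  rw [div_le_iff₀ hη0] at k₁'
  rw [div_le_iff₀ hμ0] at k₂'
  rw [div_lt_iff₀ (by positivity)] at k₃'
  obtain ⟨β, τ, hβ, hβε, hβτ, hτ⟩ := exists_cluster_parameters hkpos hε0 hε1 hVN (by
    have : 1 + (k : ℝ) * (13 + 2 * k ^ 2) ≤ 1 + M * (13 + 2 * M ^ 2) := by gcongr
    linarith)
  set θ : Fin 3 → ℝ := fun i => 2 * α i / K + η with hθ
  have hθη : ∀ i, η ≤ θ i := fun i => by
    have : 0 ≤ 2 * α i / K := by have := hα i; positivity
    simp only [hθ]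
    linarith
  have hθ0 : ∀ i, 0 ≤ θ i * k := fun i =>
    mul_nonneg (hη0.le.trans (hθη i)) hk0.le
  have hA : ∀ i, (2 * α i / K + η / 2) * k ≤ ⌊θ i * k⌋₊ := by
    intro i
    have := Nat.lt_floor_add_one (θ i * k)
    simp only [hθ] at this ⊢
    nlinarith
  have hl : ∀ i, (M : ℝ) ^ 2 + 2 ≤ ⌊α i * n⌋₊ := fun i => by
    linarith [Nat.lt_floor_add_one (α i * n), c₃ i]
  have hl' : ∀ i, M ^ 2 + 2 ≤ ⌊α i * n⌋₊ := fun i => by exact_mod_cast hl i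
  have hkM2 : k ^ 2 ≤ M ^ 2 := Nat.pow_le_pow_left hPM 2
  suffices h : ∃ (i : Fin 3) (x : V) (p : (G i).Walk x x),
      p.IsCycle ∧ p.length = 2 * (⌊α i * n⌋₊ - 1 + 1) by
    obtain ⟨i, x, p, hp, hpl⟩ := h
    refine ⟨i, x, p, hp, ?_⟩
    have := hl' i
    rw [hpl]
    omega
  refine P.exists_mono_cycle G hG hε0.le (hε1.trans (by norm_num)) hPu
    (A := fun i => ⌊θ i * k⌋₊) (τ := fun _ => τ) (l := fun i => ⌊α i * n⌋₊ - 1) (β := β) (r := r)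
    (m := ⌊μ * k⌋₊) (M := ⌊θ 0 * k⌋₊) hβ ?_ ?_ ?_ ?_ ?_ ?_ ?_ ?_ ?_
  · intro S hS
    have h := hPe.card_part_le_average_add_one hS
    rw [card_univ] at h
    have h' : (#S : ℝ) ≤ (Fintype.card V / k : ℕ) + 1 := by exact_mod_cast h
    exact (mul_le_mul_of_nonneg_right h' hε0.le).trans hβε
  · intro i
    have := hl' i
    exact hkM2.trans (by omega)
  · intro i
    have := hl' i
    omega
  · intro i
    have e1 : α i * n ≤ (⌊θ i * k⌋₊ * τ : ℝ) := by
      have f1 : 0 < α i := hα i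
      have f2 : (2 * α i / K + η / 2) * (K * n * (1 - 9 * ε)) ≤
          (2 * α i / K + η / 2) * (k * (2 * τ)) := by gcongr
      have f3 : (2 * α i / K + η / 2) * k * τ ≤ ⌊θ i * k⌋₊ * (τ : ℝ) := by
        gcongr
        exact hA i
      have f4 : (2 * α i / K + η / 2) * (K * n * (1 - 9 * ε)) =
          2 * ((α i + δ / 16) * (1 - 9 * ε)) * n := by
        have : (2 * α i / K + η / 2) * K = 2 * (α i + δ / 16) := by
          rw [add_mul, div_mul_cancel₀ _ hK0.ne']
          linarith
        calc _ = (2 * α i / K + η / 2) * K * n * (1 - 9 * ε) := by ring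
          _ = _ := by rw [this]; ring
      have f5 : α i ≤ (α i + δ / 16) * (1 - 9 * ε) := by
        rw [le_div_iff₀ (by positivity)] at hε3
        have := mul_le_mul_of_nonneg_left (hα₀ i) hε0.le
        linarith
      have f6 : α i * n ≤ (α i + δ / 16) * (1 - 9 * ε) * n := by gcongr
      linarith
    have e2 : (⌊α i * n⌋₊ : ℝ) ≤ α i * n := Nat.floor_le (by have := hα i; positivity)
    have e3 : ⌊α i * n⌋₊ ≤ ⌊θ i * k⌋₊ * τ := by exact_mod_cast e2.trans e1
    exact (Nat.sub_le _ _).trans e3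
  · intro S hS i
    have h := hPe.average_le_card_part hS
    rw [card_univ] at h
    exact hβτ.trans h
  · intro i
    refine Nat.floor_le_floor (mul_le_mul_of_nonneg_right ?_ hk0.le)
    simp only [hθ]
    have := hα₀ i
    gcongr
  · intro i
    have e1 : (4 * k : ℝ) < r * ⌊θ i * k⌋₊ := by
      have e2 := hA i
      have e3 : 0 ≤ 2 * α i / K := by have := hα i; positivity
      have e4 : η / 2 * k ≤ ⌊θ i * k⌋₊ := by linarith [mul_nonneg e3 hk0.le]
      rw [div_lt_iff₀ hη0] at hrη
      linarith [mul_le_mul_of_nonneg_left e4 hr0.le, mul_lt_mul_of_pos_right hrη hk0]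
    exact_mod_cast e1
  · have e1 : μ * k / 2 ≤ ⌊μ * k⌋₊ := by
      have := Nat.lt_floor_add_one (μ * k)
      linarith
    have e2 : (μ * k / 2) ^ 2 ≤ (⌊μ * k⌋₊ : ℝ) ^ 2 := by gcongr
    have e3 : (k : ℝ) ^ 2 * ε ≤ k ^ 2 * (μ ^ 2 / 24) := by gcongr
    nlinarith
  · have e0 : ∀ i, (⌊θ i * k⌋₊ : ℝ) ≤ θ i * k := fun i => Nat.floor_le (hθ0 i)
    have e1 : (⌊μ * k⌋₊ : ℝ) ≤ μ * k := Nat.floor_le (by positivity)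
    have e2 : 2 * (27 * r ^ 3 * (⌊μ * k⌋₊ : ℝ)) ≤ δ / (2 * K) * k := by
      calc 2 * (27 * r ^ 3 * (⌊μ * k⌋₊ : ℝ)) ≤ 2 * (27 * r ^ 3 * (μ * k)) := by gcongr
        _ = δ / (2 * K) * k := by
          rw [hμ]
          field_simp
          ring
    have e3 : θ 0 + θ 1 + θ 2 + θ 0 = 2 - δ / K := by
      simp only [hθ, hη]
      field_simp
      rw [hK]
      ring
    have e4 : θ 0 * k + θ 1 * k + θ 2 * k + θ 0 * k = 2 * k - δ / K * k := by
      rw [← add_mul, ← add_mul, ← add_mul, e3]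
      ring
    have e5 : δ / (2 * K) * k < δ / K * k := by
      gcongr
      linarith
    have e6 : ((⌊θ 0 * k⌋₊ + ⌊θ 1 * k⌋₊ + ⌊θ 2 * k⌋₊ + ⌊θ 0 * k⌋₊ +
        2 * (27 * r ^ 3 * ⌊μ * k⌋₊) : ℕ) : ℝ) < (2 * k : ℕ) := by
      push_cast
      have := e0 0
      have := e0 1
      have := e0 2
      linarith
    exact_mod_cast e6

/-- Color classes that cover a complete graph and contain a prescribed cycle give an arrow
relation. -/
theorem arrowsCycles_of_forall_cover {V : Type*} {k : ℕ} {m : Fin k → ℕ}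
    (h : ∀ G : Fin k → SimpleGraph V, (∀ u v, u ≠ v → ∃ i, (G i).Adj u v) →
      ∃ (i : Fin k) (x : V) (p : (G i).Walk x x), p.IsCycle ∧ p.length = m i) :
    ArrowsCycles (⊤ : SimpleGraph V) m := by
  intro c
  let G : Fin k → SimpleGraph V := fun i =>
    SimpleGraph.fromEdgeSet (Subtype.val '' (c ⁻¹' {i}))
  obtain ⟨i, x, p, hp, hpl⟩ := h G fun u v huv => by
    refine ⟨c ⟨s(u, v), by simpa using huv⟩, ?_⟩
    rw [SimpleGraph.fromEdgeSet_adj]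
    exact ⟨⟨_, rfl, rfl⟩, huv⟩
  refine ⟨i, x, p.mapLe le_top, hp.mapLe le_top, by simpa using hpl, fun e he => ?_⟩
  have he' : e ∈ p.edges := by simpa using he
  have h1 := p.edges_subset_edgeSet he'
  rw [SimpleGraph.edgeSet_fromEdgeSet] at h1
  obtain ⟨⟨e', h2, rfl⟩, -⟩ := h1
  exact h2

theorem exists_arrowsCycles_of_three (α : Fin 3 → ℝ) (hα : ∀ i, 0 < α i)
    (hα₀ : ∀ i, α i ≤ α 0) {δ : ℝ} (hδ : 0 < δ) :
    ∃ n₀ : ℕ, ∀ n : ℕ, n₀ ≤ n →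
      ArrowsCycles (⊤ : SimpleGraph (Fin ⌊(2 * α 0 + α 1 + α 2 + δ) * n⌋₊))
        fun i => 2 * ⌊α i * n⌋₊ := by
  obtain ⟨n₀, h⟩ := exists_mono_cycle_of_three_coloring α hα hα₀ hδ
  exact ⟨n₀, fun n hn => arrowsCycles_of_forall_cover fun G hG =>
    h n hn _ G (Fintype.card_fin _) hG⟩

open Finset in
theorem SimpleGraph.Walk.IsCycle.length_le_two_mul_card {V : Type*} [DecidableEq V]
    {G : SimpleGraph V} {x : V} {p : G.Walk x x} (hp : p.IsCycle) (S : Finset V)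
    (h : ∀ e ∈ p.edges, ∃ v ∈ S, v ∈ e) : p.length ≤ 2 * #S := by
  have h1 : p.darts.length ≤ (p.darts.filter (fun d => d.fst ∈ S)).length +
      (p.darts.filter (fun d => d.snd ∈ S)).length := by
    have : ∀ l : List G.Dart, (∀ d ∈ l, d.fst ∈ S ∨ d.snd ∈ S) →
        l.length ≤ (l.filter (fun d => d.fst ∈ S)).length +
          (l.filter (fun d => d.snd ∈ S)).length := by
      intro l hl
      induction l with
      | nil => simp
      | cons d l ih =>
        have := ih fun d hd => hl d (List.mem_cons_of_mem _ hd)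
        have := hl d List.mem_cons_self
        simp only [List.filter_cons, List.length_cons, decide_eq_true_eq]
        split_ifs <;> first | (simp only [List.length_cons]; omega) | tauto
    refine this _ fun d hd => ?_
    obtain ⟨v, hv, hvd⟩ := h d.edge (List.mem_map_of_mem hd)
    rcases Sym2.mem_iff.1 hvd with rfl | rfl
    exacts [Or.inl hv, Or.inr hv]
  have key : ∀ f : G.Dart → V, (p.darts.map f).Nodup →
      (p.darts.filter (fun d => f d ∈ S)).length ≤ #S := by
    intro f hf
    have h2 : ((p.darts.filter (fun d => f d ∈ S)).map f).Nodup :=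
      hf.sublist (List.filter_sublist.map f)
    rw [← List.length_map (f := f), ← List.toFinset_card_of_nodup h2]
    refine card_le_card fun v hv => ?_
    simp only [List.mem_toFinset, List.mem_map, List.mem_filter, decide_eq_true_eq] at hv
    obtain ⟨d, ⟨-, hd⟩, rfl⟩ := hv
    exact hd
  have h2 := key (fun d => d.fst) (by
    rw [p.map_fst_darts]
    exact hp.nodup_dropLast_support)
  have h3 := key (fun d => d.snd) (by
    rw [p.map_snd_darts]
    exact hp.support_nodup)
  rw [p.length_darts] at h1
  omega

open Finset in
theorem not_arrowsCycles_of_le {N : ℕ} {a : Fin 3 → ℕ} (ha : ∀ i, 0 < a i)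
    (hN : N ≤ (2 * a 0 - 1) + (a 1 - 1) + (a 2 - 1)) :
    ¬ ArrowsCycles (⊤ : SimpleGraph (Fin N)) fun i => 2 * a i := by
  classical
  intro h
  have hcard : ∀ s t : ℕ, #{v : Fin N | s ≤ v.1 ∧ v.1 < t} ≤ t - s := by
    intro s t
    rw [← Nat.card_Ico, ← card_map Fin.valEmbedding]
    refine card_le_card fun v hv => ?_
    simp only [mem_map, mem_filter, mem_univ, true_and] at hv
    obtain ⟨w, hw, rfl⟩ := hv
    exact mem_Ico.2 hw
  set S : Fin 3 → Finset (Fin N) := ![({v | 0 ≤ v.1 ∧ v.1 < 2 * a 0 - 1} : Finset (Fin N)),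
    ({v | 2 * a 0 - 1 ≤ v.1 ∧ v.1 < 2 * a 0 - 1 + (a 1 - 1)} : Finset (Fin N)),
    ({v | 2 * a 0 - 1 + (a 1 - 1) ≤ v.1 ∧ v.1 < N} : Finset (Fin N))] with hS
  have hS0 : #(S 0) ≤ 2 * a 0 - 1 := hcard _ _
  have hS1 : #(S 1) ≤ a 1 - 1 := (hcard _ _).trans (by omega)
  have hS2 : #(S 2) ≤ a 2 - 1 := (hcard _ _).trans (by omega)
  have hSu : ∀ v, v ∈ S 0 ∨ v ∈ S 1 ∨ v ∈ S 2 := by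
    intro v
    simp only [hS, Matrix.cons_val, mem_filter, mem_univ, true_and]
    have := v.2
    omega
  obtain ⟨i, x, p, hp, hpl, hc⟩ := h fun e =>
    if ∃ v ∈ S 2, v ∈ e.1 then 2 else if ∃ v ∈ S 1, v ∈ e.1 then 1 else 0
  have ha0 := ha 0
  have ha1 := ha 1
  have ha2 := ha 2
  have hc' : ∀ e ∈ p.edges,
      (if ∃ v ∈ S 2, v ∈ e then 2 else if ∃ v ∈ S 1, v ∈ e then 1 else 0) = i := hc
  obtain rfl | rfl | rfl : i = 0 ∨ i = 1 ∨ i = 2 := by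
    clear hc' hc hpl
    decide +revert
  · have h1 : p.support.tail.toFinset ⊆ S 0 := by
      intro v hv
      rw [List.mem_toFinset, ← p.map_snd_darts, List.mem_map] at hv
      obtain ⟨d, hd, rfl⟩ := hv
      have h2 := hc' d.edge (List.mem_map_of_mem hd)
      have h3 : d.snd ∈ d.edge := Sym2.mem_iff.2 (Or.inr rfl)
      split_ifs at h2 with h4 h5
      · exact absurd h2 (by decide)
      · exact absurd h2 (by decide)
      rcases hSu d.snd with h | h | h
      exacts [h, (h5 ⟨_, h, h3⟩).elim, (h4 ⟨_, h, h3⟩).elim]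
    have h2 := card_le_card h1
    rw [List.toFinset_card_of_nodup hp.support_nodup, List.length_tail, p.length_support] at h2
    dsimp at hpl
    omega
  · have := hp.length_le_two_mul_card (S 1) fun e he => by
      have h2 := hc' e he
      split_ifs at h2 <;> first | exact absurd h2 (by decide) | assumption
    dsimp at hpl
    omega
  · have := hp.length_le_two_mul_card (S 2) fun e he => by
      have h2 := hc' e he
      split_ifs at h2 <;> first | exact absurd h2 (by decide) | assumption
    dsimp at hpl
    omega

theorem stmt7 (α₁ α₂ α₃ : ℝ) (h12 : α₂ ≤ α₁) (h23 : α₃ ≤ α₂) (h3 : 0 < α₃)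
    (δ : ℝ) (hδ : 0 < δ) :
    ∃ n₀ : ℕ, ∀ n : ℕ, n₀ ≤ n →
      (2 * α₁ + α₂ + α₃ - δ) * n ≤
          (ramseyCycles ![2 * ⌊α₁ * (n : ℝ)⌋₊, 2 * ⌊α₂ * (n : ℝ)⌋₊, 2 * ⌊α₃ * (n : ℝ)⌋₊] : ℝ) ∧
      (ramseyCycles ![2 * ⌊α₁ * (n : ℝ)⌋₊, 2 * ⌊α₂ * (n : ℝ)⌋₊, 2 * ⌊α₃ * (n : ℝ)⌋₊] : ℝ) ≤
          (2 * α₁ + α₂ + α₃ + δ) * n := by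
  have h2 : 0 < α₂ := h3.trans_le h23
  have h1 : 0 < α₁ := h2.trans_le h12
  set α : Fin 3 → ℝ := ![α₁, α₂, α₃] with hα
  have hα0 : ∀ i, 0 < α i := by
    intro i
    fin_cases i
    exacts [h1, h2, h3]
  have hα1 : ∀ i, α i ≤ α 0 := by
    intro i
    fin_cases i
    exacts [le_rfl, h12, h23.trans h12]
  obtain ⟨n₁, hn₁⟩ := exists_arrowsCycles_of_three α hα0 hα1 hδ
  obtain ⟨n₂, hn₂⟩ := exists_nat_ge (7 / δ)
  obtain ⟨n₃, hn₃⟩ := exists_nat_ge (1 / α₃)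
  refine ⟨max n₁ (max n₂ n₃), fun n hn => ?_⟩
  simp only [max_le_iff] at hn
  obtain ⟨g₁, g₂, g₃⟩ := hn
  have e₂ : 7 ≤ δ * n := by
    rw [← div_le_iff₀' hδ]
    exact hn₂.trans (by exact_mod_cast g₂)
  have e₃ : 1 ≤ α₃ * n := by
    rw [← div_le_iff₀' h3]
    exact hn₃.trans (by exact_mod_cast g₃)
  have hvec : ![2 * ⌊α₁ * (n : ℝ)⌋₊, 2 * ⌊α₂ * (n : ℝ)⌋₊, 2 * ⌊α₃ * (n : ℝ)⌋₊] =
      fun i => 2 * ⌊α i * (n : ℝ)⌋₊ := by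
    funext i
    fin_cases i <;> rfl
  have harrow := hn₁ n g₁
  rw [hvec]
  constructor
  · have hmem := Nat.sInf_mem (s := {N : ℕ | ArrowsCycles (⊤ : SimpleGraph (Fin N))
      fun i => 2 * ⌊α i * (n : ℝ)⌋₊}) ⟨_, harrow⟩
    change _ ≤ ((sInf {N : ℕ | ArrowsCycles (⊤ : SimpleGraph (Fin N)) _} : ℕ) : ℝ)
    by_contra! hlt
    refine not_arrowsCycles_of_le (a := fun i => ⌊α i * (n : ℝ)⌋₊) (fun i => ?_) ?_ hmem
    · rw [Nat.floor_pos]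
      refine e₃.trans (mul_le_mul_of_nonneg_right ?_ n.cast_nonneg)
      fin_cases i
      exacts [h23.trans h12, h23, le_rfl]
    · have f₁ := Nat.lt_floor_add_one (α₁ * n)
      have f₂ := Nat.lt_floor_add_one (α₂ * n)
      have f₃ := Nat.lt_floor_add_one (α₃ * n)
      generalize sInf {N : ℕ | ArrowsCycles (⊤ : SimpleGraph (Fin N)) _} = N at hlt ⊢
      have : (N : ℝ) + 3 ≤
          ((2 * ⌊α₁ * (n : ℝ)⌋₊ + ⌊α₂ * (n : ℝ)⌋₊ + ⌊α₃ * (n : ℝ)⌋₊ : ℕ) : ℝ) := by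
        push_cast
        linarith
      have : N + 3 ≤ 2 * ⌊α₁ * (n : ℝ)⌋₊ + ⌊α₂ * (n : ℝ)⌋₊ + ⌊α₃ * (n : ℝ)⌋₊ := by
        exact_mod_cast this
      change N ≤ (2 * ⌊α₁ * (n : ℝ)⌋₊ - 1) + (⌊α₂ * (n : ℝ)⌋₊ - 1) + (⌊α₃ * (n : ℝ)⌋₊ - 1)
      omega
  · have hle : ramseyCycles (fun i => 2 * ⌊α i * (n : ℝ)⌋₊) ≤ _ := Nat.sInf_le harrow
    refine (Nat.cast_le.2 hle).trans (Nat.floor_le ?_)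
    have := hα0 0
    have := hα0 1
    have := hα0 2
    positivity
end

section
/- Let 0 < ε < 1/2 and 0 < d ≤ 1 be reals, and let G be a graph containing disjoint vertex sets U, W with |U| = |W| = m. Suppose the pair (U,W) is ε-regular in G with density d_G(U,W) ≥ d. Then there exist subsets U₁ ⊆ U and W₁ ⊆ W with |U₁| = |W₁| = ⌈(1−ε)m⌉ such that the pair (U₁,W₁) is 2ε-regular in G, every vertex of U₁ has more than (d−2ε)|W₁| neighbors in W₁, and every vertex of W₁ has more than (d−2ε)|U₁| neighbors in U₁. -/
-- The number of edges of `G` with one endpoint in `U` and the other in `W`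
-- (for disjoint `U`, `W`).
open Classical in
noncomputable def edgesBetween {V : Type*} (G : SimpleGraph V) (U W : Finset V) : ℕ :=
  ((U ×ˢ W).filter fun e => G.Adj e.1 e.2).card

/-- The density `d_G(U,W) = e_G(U,W) / (|U||W|)`. -/
noncomputable def pairDensity {V : Type*} (G : SimpleGraph V) (U W : Finset V) : ℝ :=
  (edgesBetween G U W : ℝ) / ((U.card : ℝ) * (W.card : ℝ))

/-- The pair `(U, W)` is `ε`-regular in `G`. -/
def IsRegularPair {V : Type*} (G : SimpleGraph V) (ε : ℝ) (U W : Finset V) : Prop :=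
  ∀ X ⊆ U, ∀ Y ⊆ W, ε * U.card ≤ X.card → ε * W.card ≤ Y.card →
    |pairDensity G X Y - pairDensity G U W| ≤ ε

-- The number of neighbors of `v` lying in `S`.
open Classical in
noncomputable def degIn {V : Type*} (G : SimpleGraph V) (v : V) (S : Finset V) : ℕ :=
  (S.filter fun w => G.Adj v w).card

open Classical in
theorem edgesBetween_eq_sum_degIn {V : Type*} (G : SimpleGraph V) (X Y : Finset V) :
    edgesBetween G X Y = ∑ u ∈ X, degIn G u Y := by
  simp only [edgesBetween, degIn, Finset.card_filter, Finset.sum_product]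

theorem edgesBetween_comm {V : Type*} (G : SimpleGraph V) (X Y : Finset V) :
    edgesBetween G X Y = edgesBetween G Y X := by
  classical
  simp only [edgesBetween, Finset.card_filter, Finset.sum_product]
  rw [Finset.sum_comm]
  simp only [G.adj_comm]

theorem pairDensity_comm {V : Type*} (G : SimpleGraph V) (X Y : Finset V) :
    pairDensity G X Y = pairDensity G Y X := by
  rw [pairDensity, pairDensity, edgesBetween_comm, mul_comm (X.card : ℝ)]

theorem IsRegularPair.symm {V : Type*} {G : SimpleGraph V} {ε : ℝ} {U W : Finset V}
    (h : IsRegularPair G ε U W) : IsRegularPair G ε W U := by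
  intro X hX Y hY hXc hYc
  rw [pairDensity_comm G X, pairDensity_comm G W]
  exact h Y hY X hX hYc hXc

open Classical in
theorem degIn_add_degIn_sdiff {V : Type*} (G : SimpleGraph V) (u : V) {Y W : Finset V}
    (h : Y ⊆ W) : degIn G u Y + degIn G u (W \ Y) = degIn G u W := by
  simp only [degIn, Finset.card_filter]
  rw [add_comm, Finset.sum_sdiff h]

theorem degIn_le_card {V : Type*} (G : SimpleGraph V) (u : V) (Y : Finset V) :
    degIn G u Y ≤ Y.card := by
  classical
  exact Finset.card_filter_le _ _

theorem degIn_le_degIn_add_card_sub {V : Type*} (G : SimpleGraph V) (u : V) {Y W : Finset V}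
    (h : Y ⊆ W) : (degIn G u W : ℝ) ≤ degIn G u Y + (W.card - Y.card) := by
  classical
  have h1 := degIn_add_degIn_sdiff G u h
  have h2 := degIn_le_card G u (W \ Y)
  have h3 := Finset.card_sdiff_add_card_eq_card h
  have h4 : degIn G u W + Y.card ≤ degIn G u Y + W.card := by omega
  have h5 : (degIn G u W : ℝ) + Y.card ≤ degIn G u Y + W.card := by exact_mod_cast h4
  linarith

open Classical in
theorem edgesBetween_add_edgesBetween_sdiff {V : Type*} (G : SimpleGraph V) (X : Finset V)
    {Y W : Finset V} (h : Y ⊆ W) :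
    edgesBetween G X Y + edgesBetween G X (W \ Y) = edgesBetween G X W := by
  simp only [edgesBetween_eq_sum_degIn, ← Finset.sum_add_distrib, degIn_add_degIn_sdiff G _ h]

theorem IsRegularPair.mul_card_le_edgesBetween {V : Type*} {G : SimpleGraph V} {ε d : ℝ}
    {U W X Y : Finset V} (h : IsRegularPair G ε U W) (hd : d ≤ pairDensity G U W)
    (hX : X ⊆ U) (hY : Y ⊆ W) (hXc : ε * U.card ≤ X.card) (hYc : ε * W.card ≤ Y.card) :
    (d - ε) * (X.card * Y.card) ≤ (edgesBetween G X Y : ℝ) := by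
  rcases (by positivity : (0 : ℝ) ≤ X.card * Y.card).eq_or_lt with h0 | h0
  · rw [← h0, mul_zero]
    positivity
  · have h1 := (abs_le.1 (h X hX Y hY hXc hYc)).1
    rw [← le_div_iff₀ h0]
    rw [pairDensity] at h1
    linarith

/-- Fewer than `ε|U|` vertices have degree below `(d - ε)|W|`. -/
theorem IsRegularPair.card_lt_of_degIn_lt {V : Type*} {G : SimpleGraph V} {ε d : ℝ}
    {U W B : Finset V} (h : IsRegularPair G ε U W) (hd : d ≤ pairDensity G U W)
    (hε0 : 0 < ε) (hε1 : ε ≤ 1) (hU : U.Nonempty) (hB : B ⊆ U)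
    (hdeg : ∀ u ∈ B, (degIn G u W : ℝ) < (d - ε) * W.card) : (B.card : ℝ) < ε * U.card := by
  by_contra! hc
  have hUc : (0 : ℝ) < U.card := by exact_mod_cast hU.card_pos
  have hBn : B.Nonempty := by
    rw [← Finset.card_pos]
    exact_mod_cast (mul_pos hε0 hUc).trans_le hc
  have h1 := h.mul_card_le_edgesBetween hd hB subset_rfl hc
    (mul_le_of_le_one_left (Nat.cast_nonneg _) hε1)
  have h2 : (edgesBetween G B W : ℝ) < ∑ _u ∈ B, (d - ε) * W.card := by
    rw [edgesBetween_eq_sum_degIn, Nat.cast_sum]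
    exact Finset.sum_lt_sum_of_nonempty hBn hdeg
  rw [Finset.sum_const, nsmul_eq_mul] at h2
  linarith

/-- In an `ε`-regular pair of density at least `2ε` whose parts have size `m` with `εm = a`
an integer, at most `a` vertices have degree at most `a`. -/
theorem IsRegularPair.card_le_of_degIn_le {V : Type*} {G : SimpleGraph V} {ε : ℝ}
    {U W B : Finset V} (h : IsRegularPair G ε U W) (hd : 2 * ε ≤ pairDensity G U W)
    (hε0 : 0 < ε) (hε : ε < 1 / 2) {m a : ℕ} (hm : 0 < m) (hU : U.card = m) (hW : W.card = m)
    (ha : (a : ℝ) = ε * m) (hB : B ⊆ U) (hdeg : ∀ u ∈ B, degIn G u W ≤ a) : B.card ≤ a := by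
  classical
  by_contra! hc
  have hm' : (0 : ℝ) < m := by exact_mod_cast hm
  have h2a : 2 * a ≤ m := by
    have : (2 : ℝ) * a ≤ m := by rw [ha]; nlinarith
    exact_mod_cast this
  have hlow : ∀ X ⊆ B, a ≤ X.card → ∀ Y ⊆ W, a ≤ Y.card →
      ε * (X.card * Y.card) ≤ (edgesBetween G X Y : ℝ) := by
    intro X hX hXc Y hY hYc
    have := h.mul_card_le_edgesBetween hd (hX.trans hB) hY
      (by rw [hU, ← ha]; exact_mod_cast hXc) (by rw [hW, ← ha]; exact_mod_cast hYc)
    linarith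
  have hup : ∀ X ⊆ B, a ≤ X.card → ∀ Y ⊆ W, Y.card = a →
      (edgesBetween G X Y : ℝ) ≤ ε * (X.card * a) := by
    intro X hX hXc Y hY hYc
    have h1 : edgesBetween G X W ≤ X.card * a := by
      rw [edgesBetween_eq_sum_degIn, ← smul_eq_mul]
      exact Finset.sum_le_card_nsmul _ _ _ fun u hu => hdeg u (hX hu)
    have h1' : (edgesBetween G X W : ℝ) ≤ X.card * a := by exact_mod_cast h1
    have h2 := Finset.card_sdiff_add_card_eq_card hY
    have h2' : ((W \ Y).card : ℝ) = m - a := by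
      rw [hYc, hW] at h2
      rw [← h2]
      push_cast
      ring
    have h3 := hlow X hX hXc (W \ Y) Finset.sdiff_subset (by omega)
    have h4 : (edgesBetween G X Y : ℝ) + edgesBetween G X (W \ Y) = edgesBetween G X W := by
      exact_mod_cast edgesBetween_add_edgesBetween_sdiff G X hY
    rw [h2'] at h3
    have h5 : (X.card : ℝ) * a = ε * (X.card * m) := by rw [ha]; ring
    linarith
  obtain ⟨b, hb⟩ : B.Nonempty := Finset.card_pos.1 (by omega)
  have hN : (W.filter fun w => ¬ G.Adj b w).card + degIn G b W = W.card := by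
    rw [add_comm, degIn]
    convert Finset.card_filter_add_card_filter_not (s := W) (fun w => G.Adj b w)
  have hbW := hdeg b hb
  obtain ⟨Y, hYN, hYc⟩ := Finset.exists_subset_card_eq
    (show a ≤ (W.filter fun w => ¬ G.Adj b w).card by omega)
  have hYW : Y ⊆ W := hYN.trans (Finset.filter_subset _ _)
  have hbY : degIn G b Y = 0 := by
    rw [degIn, Finset.card_eq_zero, Finset.filter_eq_empty_iff]
    exact fun w hw => (Finset.mem_filter.1 (hYN hw)).2
  have hce := Finset.card_erase_add_one hb
  have h1 := hup (B.erase b) (Finset.erase_subset _ _) (by omega) Y hYW hYc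
  have h2 := hlow B subset_rfl hc.le Y hYW hYc.ge
  have h3 : edgesBetween G B Y = edgesBetween G (B.erase b) Y := by
    rw [edgesBetween_eq_sum_degIn, edgesBetween_eq_sum_degIn, ← Finset.sum_erase_add _ _ hb, hbY,
      add_zero]
  have h4 : (B.card : ℝ) = (B.erase b).card + 1 := by exact_mod_cast hce.symm
  rw [h3, hYc, h4] at h2
  have h5 : 0 < ε * (a : ℝ) := by rw [ha]; positivity
  linarith

theorem exists_subset_sdiff_card_eq_ceil {V : Type*} [DecidableEq V] {U B : Finset V} {ε : ℝ}
    {m : ℕ} (hU : U.card = m) (hB : B ⊆ U) (hBc : (B.card : ℝ) ≤ ε * m) :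
    ∃ U₁ ⊆ U \ B, U₁.card = ⌈(1 - ε) * (m : ℝ)⌉₊ := by
  apply Finset.exists_subset_card_eq
  rw [Nat.ceil_le]
  have h : ((U \ B).card : ℝ) + B.card = m := by
    rw [← hU]
    exact_mod_cast Finset.card_sdiff_add_card_eq_card hB
  linarith

theorem IsRegularPair.exists_subset_lt_degIn {V : Type*} {G : SimpleGraph V} {ε d : ℝ}
    {U W : Finset V} (h : IsRegularPair G ε U W) (hd : d ≤ pairDensity G U W)
    (hε0 : 0 < ε) (hε : ε < 1 / 2) {m : ℕ} (hm : 0 < m) (hU : U.card = m) (hW : W.card = m) :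
    ∃ U₁ ⊆ U, U₁.card = ⌈(1 - ε) * (m : ℝ)⌉₊ ∧
      ∀ u ∈ U₁, ∀ W₁ ⊆ W, W₁.card = ⌈(1 - ε) * (m : ℝ)⌉₊ →
        (d - 2 * ε) * W₁.card < (degIn G u W₁ : ℝ) := by
  classical
  have hm' : (0 : ℝ) < m := by exact_mod_cast hm
  have hk : (1 - ε) * (m : ℝ) ≤ (⌈(1 - ε) * (m : ℝ)⌉₊ : ℝ) := Nat.le_ceil _
  have hk0 : (0 : ℝ) < (⌈(1 - ε) * (m : ℝ)⌉₊ : ℝ) := by nlinarith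
  have hkm : ⌈(1 - ε) * (m : ℝ)⌉₊ ≤ m := Nat.ceil_le.2 (by nlinarith)
  generalize hkdef : ⌈(1 - ε) * (m : ℝ)⌉₊ = k at hk hk0 hkm
  have hkm' : (k : ℝ) ≤ m := by exact_mod_cast hkm
  rcases lt_or_ge d (2 * ε) with hd2 | hd2
  · obtain ⟨U₁, hU₁, hc⟩ := Finset.exists_subset_card_eq (hU ▸ hkm)
    refine ⟨U₁, hU₁, hc, fun u _ W₁ _ hW₁c => ?_⟩
    rw [hW₁c]
    have : (0 : ℝ) ≤ degIn G u W₁ := Nat.cast_nonneg _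
    nlinarith
  · by_cases hcase : d = 2 * ε ∧ ∃ a : ℕ, (a : ℝ) = ε * m
    · obtain ⟨rfl, a, ha⟩ := hcase
      have hBc := h.card_le_of_degIn_le hd hε0 hε hm hU hW ha
        (Finset.filter_subset (fun u => degIn G u W ≤ a) U)
        (fun u hu => (Finset.mem_filter.1 hu).2)
      obtain ⟨U₁, hU₁, hc⟩ := exists_subset_sdiff_card_eq_ceil hU (Finset.filter_subset _ _)
        (ha ▸ Nat.cast_le.2 hBc)
      refine ⟨U₁, hU₁.trans Finset.sdiff_subset, hc.trans hkdef, fun u hu W₁ hW₁ hW₁c => ?_⟩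
      have hu' := hU₁ hu
      simp only [Finset.mem_sdiff, Finset.mem_filter, not_and, not_le] at hu'
      have h1 : (a : ℝ) < degIn G u W := by exact_mod_cast hu'.2 hu'.1
      have h2 := degIn_le_degIn_add_card_sub G u hW₁
      rw [hW, hW₁c] at h2
      linarith
    · have hBc := h.card_lt_of_degIn_lt hd hε0 (by linarith) (Finset.card_pos.1 (hU ▸ hm))
        (Finset.filter_subset (fun u => (degIn G u W : ℝ) < (d - ε) * W.card) U)
        (fun u hu => (Finset.mem_filter.1 hu).2)
      obtain ⟨U₁, hU₁, hc⟩ := exists_subset_sdiff_card_eq_ceil hU (Finset.filter_subset _ _)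
        (hU ▸ hBc.le)
      refine ⟨U₁, hU₁.trans Finset.sdiff_subset, hc.trans hkdef, fun u hu W₁ hW₁ hW₁c => ?_⟩
      have hu' := hU₁ hu
      simp only [Finset.mem_sdiff, Finset.mem_filter, not_and, not_lt] at hu'
      have h1 := hu'.2 hu'.1
      have h2 := degIn_le_degIn_add_card_sub G u hW₁
      rw [hW, hW₁c] at h2
      rw [hW] at h1
      rw [hW₁c]
      rcases hd2.eq_or_lt with hd2 | hd2
      · have h3 : (m : ℝ) - k ≠ ε * m := fun h3 =>
          hcase ⟨hd2.symm, m - k, by rw [Nat.cast_sub hkm, h3]⟩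
        have h4 : (m : ℝ) - k < ε * m := lt_of_le_of_ne (by linarith) h3
        rw [← hd2] at h1 ⊢
        linarith
      · rcases hkm'.eq_or_lt with h3 | h3
        · rw [h3] at h2 ⊢
          nlinarith [mul_pos hε0 hm']
        · nlinarith [mul_pos (sub_pos.2 hd2) (sub_pos.2 h3)]

theorem IsRegularPair.mono {V : Type*} {G : SimpleGraph V} {ε : ℝ} {U W U₁ W₁ : Finset V}
    (h : IsRegularPair G ε U W) (hε0 : 0 < ε) (hε : ε < 1 / 2) (hU₁ : U₁ ⊆ U) (hW₁ : W₁ ⊆ W)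
    (hU₁c : (1 - ε) * U.card ≤ (U₁.card : ℝ)) (hW₁c : (1 - ε) * W.card ≤ (W₁.card : ℝ)) :
    IsRegularPair G (2 * ε) U₁ W₁ := by
  have large : ∀ {S T : ℝ}, 0 ≤ S → (1 - ε) * S ≤ T → ε * S ≤ 2 * ε * T ∧ ε * S ≤ T := by
    intro S T hS hT
    have h1 : S ≤ 2 * T := by nlinarith
    exact ⟨by nlinarith, by nlinarith⟩
  have hU := large (Nat.cast_nonneg _) hU₁c
  have hW := large (Nat.cast_nonneg _) hW₁c
  intro X hX Y hY hXc hYc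
  have h1 := abs_le.1 (h X (hX.trans hU₁) Y (hY.trans hW₁) (hU.1.trans hXc) (hW.1.trans hYc))
  have h2 := abs_le.1 (h U₁ hU₁ W₁ hW₁ hU.2 hW.2)
  rw [abs_le]
  constructor <;> linarith

theorem stmt9 {V : Type*} (G : SimpleGraph V) (ε d : ℝ) (hε0 : 0 < ε) (hε : ε < 1 / 2)
    (hd0 : 0 < d) (hd1 : d ≤ 1) (U W : Finset V) (m : ℕ) (hU : U.card = m) (hW : W.card = m)
    (hdisj : Disjoint U W) (hreg : IsRegularPair G ε U W) (hdens : d ≤ pairDensity G U W) :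
    ∃ U₁ ⊆ U, ∃ W₁ ⊆ W, U₁.card = ⌈(1 - ε) * (m : ℝ)⌉₊ ∧ W₁.card = ⌈(1 - ε) * (m : ℝ)⌉₊ ∧
      IsRegularPair G (2 * ε) U₁ W₁ ∧
      (∀ u ∈ U₁, (d - 2 * ε) * W₁.card < (degIn G u W₁ : ℝ)) ∧
      (∀ w ∈ W₁, (d - 2 * ε) * U₁.card < (degIn G w U₁ : ℝ)) := by
  have hm : 0 < m := by
    rcases Nat.eq_zero_or_pos m with rfl | hm
    · rw [pairDensity, hU] at hdens
      norm_num at hdens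
      linarith
    · exact hm
  obtain ⟨U₁, hU₁, hU₁c, hU₁d⟩ := hreg.exists_subset_lt_degIn hdens hε0 hε hm hU hW
  obtain ⟨W₁, hW₁, hW₁c, hW₁d⟩ := hreg.symm.exists_subset_lt_degIn
    (hdens.trans_eq (pairDensity_comm G U W)) hε0 hε hm hW hU
  refine ⟨U₁, hU₁, W₁, hW₁, hU₁c, hW₁c, hreg.mono hε0 hε hU₁ hW₁ ?_ ?_,
    fun u hu => hU₁d u hu W₁ hW₁ hW₁c, fun w hw => hW₁d w hw U₁ hU₁ hU₁c⟩
  · rw [hU, hU₁c]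
    exact Nat.le_ceil _
  · rw [hW, hW₁c]
    exact Nat.le_ceil _
end
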